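/- arXiv:1606.06428 — 11 statements merged into one kernel-verified Lean document; each statement's English description precedes it below -/
import Mathlib

section
/- The ring 𝓡 = R[x]/⟨x^{np^s} − (α + uβ)⟩ is a chain ring (its ideals are linearly ordered by inclusion), with unique maximal ideal ⟨x^n − α₀⟩, and its ideals are precisely the principal ideals ⟨(x^n − α₀)^i⟩ for 0 ≤ i ≤ 2p^s, which form a strictly decreasing chain 𝓡 = ⟨1⟩ ⊋ ⟨x^n − α₀⟩ ⊋ ⋯ ⊋ ⟨(x^n − α₀)^{2p^s − 1}⟩ ⊋ ⟨(x^n − α₀)^{2p^s}⟩ = ⟨0⟩. -/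
open Polynomial

/-- `α + uβ` as an element of `R = F + uF = DualNumber F`
(where `u = DualNumber.eps` satisfies `u² = 0`). -/
noncomputable def lamAdd (F : Type) [Field F] (α β : F) : DualNumber F :=
  algebraMap F (DualNumber F) α + DualNumber.eps * algebraMap F (DualNumber F) β

/-- The ambient ring `R[x]/⟨x^N − l⟩`, realized as `AdjoinRoot (X^N - C l)`,
which is by definition the quotient ring `R[x] ⧸ ⟨X^N - C l⟩`. -/
noncomputable abbrev Amb (F : Type) [Field F] (N : ℕ) (l : DualNumber F) : Type :=
  AdjoinRoot ((X : (DualNumber F)[X]) ^ N - C l)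

/-- The natural projection `R[x] → R[x]/⟨x^N − l⟩`. -/
noncomputable abbrev ambMk (F : Type) [Field F] (N : ℕ) (l : DualNumber F) :
    (DualNumber F)[X] →+* Amb F N l :=
  AdjoinRoot.mk _

theorem isUnit_one_add_mul_of_pow_eq_zero {A : Type*} [CommRing A] {e : A} {N : ℕ}
    (h : e ^ N = 0) (d : A) : IsUnit (1 + e * d) :=
  IsNilpotent.isUnit_one_add ⟨N, by rw [mul_pow, h, zero_mul]⟩

section NilpotentUniformizer

variable {A : Type*} [CommRing A] {e : A} {N : ℕ}

theorem exists_eq_span_pow_of_dvd_or_isUnit (hN : e ^ N = 0)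
    (h : ∀ a, e ∣ a ∨ IsUnit a) (I : Ideal A) : ∃ i ≤ N, I = Ideal.span {e ^ i} := by
  classical
  have hex : ∃ i, e ^ i ∈ I := ⟨N, hN ▸ I.zero_mem⟩
  refine ⟨Nat.find hex, Nat.find_min' hex (hN ▸ I.zero_mem), le_antisymm ?_ ?_⟩
  · intro a ha
    have key : ∀ k ≤ Nat.find hex, e ^ k ∣ a := by
      intro k
      induction k with
      | zero => simp
      | succ k ih =>
        intro hk
        obtain ⟨c, rfl⟩ := ih (by omega)
        rcases h c with hc | hc
        · rw [pow_succ]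
          exact mul_dvd_mul_left _ hc
        · refine absurd ?_ (Nat.find_min hex (m := k) (by omega))
          exact (Ideal.mul_unit_mem_iff_mem I hc).1 ha
    exact Ideal.mem_span_singleton.2 (key _ le_rfl)
  · rw [Ideal.span_singleton_le_iff_mem]
    exact Nat.find_spec hex

theorem span_pow_lt_span_pow (hN : e ^ N = 0) (hne : e ^ (N - 1) ≠ 0) {i j : ℕ}
    (hj : j ≤ N) (hij : i < j) : Ideal.span {e ^ j} < Ideal.span {e ^ i} := by
  refine lt_of_le_not_ge (Ideal.span_singleton_le_span_singleton.2 (pow_dvd_pow e hij.le)) ?_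
  rw [Ideal.span_singleton_le_span_singleton]
  rintro ⟨c, hc⟩
  obtain ⟨k, rfl⟩ := Nat.exists_eq_add_of_lt hij
  have hu := isUnit_one_add_mul_of_pow_eq_zero hN (-(e ^ k * c))
  have h0 : e ^ i * (1 + e * -(e ^ k * c)) = 0 := by
    have : e ^ i * (1 + e * -(e ^ k * c)) = e ^ i - e ^ (i + k + 1) * c := by ring
    rw [this, ← hc, sub_self]
  rw [hu.mul_left_eq_zero] at h0
  exact hne (pow_eq_zero_of_le (by omega) h0)

theorem isMaximal_span_of_dvd_or_isUnit (he : ¬ IsUnit e) (h : ∀ a, e ∣ a ∨ IsUnit a) :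
    (Ideal.span {e}).IsMaximal := by
  rw [Ideal.isMaximal_iff]
  refine ⟨fun h1 => he (isUnit_of_dvd_one (Ideal.mem_span_singleton.1 h1)), ?_⟩
  intro J a _ ha haJ
  rw [Ideal.mem_span_singleton] at ha
  rw [← Ideal.eq_top_iff_one]
  exact J.eq_top_of_isUnit_mem haJ ((h a).resolve_left ha)

theorem eq_span_of_isMaximal (he : IsNilpotent e) (hmax : (Ideal.span {e}).IsMaximal)
    {I : Ideal A} (hI : I.IsMaximal) : I = Ideal.span {e} := by
  refine (hmax.eq_of_le hI.ne_top ?_).symm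
  obtain ⟨N, hN⟩ := he
  rw [Ideal.span_singleton_le_iff_mem]
  exact hI.isPrime.mem_of_pow_mem N (hN ▸ I.zero_mem)

end NilpotentUniformizer

theorem C_eps_dvd_sub_map_fst {F : Type*} [Field F] (P : (DualNumber F)[X]) :
    ∃ f : F[X], C DualNumber.eps ∣ P - f.map (algebraMap F (DualNumber F)) := by
  refine ⟨P.map (TrivSqZeroExt.fstHom F F F).toRingHom, ?_⟩
  rw [C_dvd_iff_dvd_coeff]
  intro i
  refine ⟨algebraMap F (DualNumber F) (P.coeff i).snd, ?_⟩
  ext <;> simp [TrivSqZeroExt.algebraMap_eq_inl]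

theorem X_pow_sub_C_pow_char_pow {F : Type*} [Field F] (p : ℕ) [Fact p.Prime] [CharP F p]
    (n s : ℕ) (a : F) :
    ((X : F[X]) ^ n - C a) ^ p ^ s = X ^ (n * p ^ s) - C (a ^ p ^ s) := by
  rw [sub_pow_char_pow, ← pow_mul, C_pow]

section Amb

variable {F : Type} [Field F] {N : ℕ} {α β : F}

theorem ambMk_map_X_pow_sub_C :
    ambMk F N (lamAdd F α β) ((X ^ N - C α : F[X]).map (algebraMap F (DualNumber F))) =
      ambMk F N (lamAdd F α β) (C DualNumber.eps) *
        ambMk F N (lamAdd F α β) (C (algebraMap F (DualNumber F) β)) := by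
  rw [← map_mul, ← C_mul]
  refine AdjoinRoot.mk_eq_mk.2 ⟨1, ?_⟩
  simp only [lamAdd, Polynomial.map_sub, Polynomial.map_pow, map_X, map_C, map_add, map_mul]
  ring

theorem ambMk_C_eps_mul_map_ne_zero (hN : N ≠ 0) {f : F[X]} (hf : f.Monic)
    (hdeg : f.natDegree < N) :
    ambMk F N (lamAdd F α β) (C DualNumber.eps * f.map (algebraMap F (DualNumber F))) ≠ 0 := by
  refine AdjoinRoot.mk_ne_zero_of_natDegree_lt (monic_X_pow_sub_C _ hN) ?_ ?_
  · intro h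
    have h1 := congrArg (fun q => q.coeff f.natDegree) h
    have h2 := congrArg TrivSqZeroExt.snd h1
    simp [hf.coeff_natDegree] at h2
  · rw [natDegree_X_pow_sub_C]
    exact (natDegree_C_mul_le _ _).trans_lt (natDegree_map_le.trans_lt hdeg)

theorem ambMk_dvd_or_isUnit {π : F[X]} (hπ : Irreducible π)
    (hnil : IsNilpotent (ambMk F N (lamAdd F α β) (π.map (algebraMap F (DualNumber F)))))
    (heps : ambMk F N (lamAdd F α β) (π.map (algebraMap F (DualNumber F))) ∣
      ambMk F N (lamAdd F α β) (C DualNumber.eps)) (a : Amb F N (lamAdd F α β)) :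
    ambMk F N (lamAdd F α β) (π.map (algebraMap F (DualNumber F))) ∣ a ∨ IsUnit a := by
  obtain ⟨P, rfl⟩ := AdjoinRoot.mk_surjective a
  obtain ⟨f, hf⟩ := C_eps_dvd_sub_map_fst P
  have hd := heps.trans (map_dvd (ambMk F N (lamAdd F α β)) hf)
  rw [map_sub] at hd
  by_cases hπf : π ∣ f
  · left
    exact (dvd_sub_left (map_dvd (ambMk F N (lamAdd F α β))
      (map_dvd (mapRingHom (algebraMap F (DualNumber F))) hπf))).1 hd
  · right
    obtain ⟨b, c, hbc⟩ := hπ.coprime_iff_not_dvd.2 hπf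
    obtain ⟨k, hk⟩ := hnil
    obtain ⟨d, hd⟩ := hd
    have h1 := congrArg (fun q : F[X] => ambMk F N (lamAdd F α β)
      (q.map (algebraMap F (DualNumber F)))) hbc
    simp only [Polynomial.map_add, Polynomial.map_mul, Polynomial.map_one, map_add, map_mul,
      map_one] at h1
    refine isUnit_of_mul_isUnit_right
      (x := ambMk F N (lamAdd F α β) (c.map (algebraMap F (DualNumber F)))) ?_
    convert isUnit_one_add_mul_of_pow_eq_zero hk
      (ambMk F N (lamAdd F α β) (c.map (algebraMap F (DualNumber F))) * d -
        ambMk F N (lamAdd F α β) (b.map (algebraMap F (DualNumber F)))) using 1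
    linear_combination
      h1 + ambMk F N (lamAdd F α β) (c.map (algebraMap F (DualNumber F))) * hd

end Amb

/-- If `x^n - α₀` is irreducible in `F[x]`, then
`𝓡 = R[x]/⟨x^{np^s} - (α + uβ)⟩` is a chain ring: its ideals are linearly ordered by
inclusion; `⟨x^n - α₀⟩` is its unique maximal ideal; its ideals are precisely the
`⟨(x^n - α₀)^i⟩` for `0 ≤ i ≤ 2p^s`, which form a strictly decreasing chain from
`⟨1⟩ = 𝓡` down to `⟨(x^n - α₀)^{2p^s}⟩ = ⟨0⟩`. -/
theorem stmt_2 (p m n s : ℕ) (hp : p.Prime) (hm : 0 < m) (hn : 0 < n) (hs : 0 < s)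
    (hnp : Nat.gcd n p = 1)
    (F : Type) [Field F] [Fintype F] (hF : Fintype.card F = p ^ m)
    (α β α₀ : F) (hα : α ≠ 0) (hβ : β ≠ 0) (hα₀ : α₀ ^ p ^ s = α)
    (hirr : Irreducible ((X : F[X]) ^ n - C α₀))
    (e : Amb F (n * p ^ s) (lamAdd F α β))
    (he : e = ambMk F (n * p ^ s) (lamAdd F α β)
      ((X ^ n - C α₀ : F[X]).map (algebraMap F (DualNumber F)))) :
    (∀ I J : Ideal (Amb F (n * p ^ s) (lamAdd F α β)), I ≤ J ∨ J ≤ I) ∧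
    (Ideal.span {e}).IsMaximal ∧
    (∀ I : Ideal (Amb F (n * p ^ s) (lamAdd F α β)), I.IsMaximal → I = Ideal.span {e}) ∧
    (∀ I : Ideal (Amb F (n * p ^ s) (lamAdd F α β)), ∃ i ≤ 2 * p ^ s, I = Ideal.span {e ^ i}) ∧
    (∀ i j : ℕ, i ≤ 2 * p ^ s → j ≤ 2 * p ^ s → i < j →
      Ideal.span {e ^ j} < Ideal.span {e ^ i}) ∧
    Ideal.span {e ^ (2 * p ^ s)} = (⊥ : Ideal (Amb F (n * p ^ s) (lamAdd F α β))) := by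
  have : Fact p.Prime := ⟨hp⟩
  have : CharP F p := charP_of_card_eq_prime_pow hF
  have hps : 0 < p ^ s := pow_pos hp.pos s
  have hN : n * p ^ s ≠ 0 := (Nat.mul_pos hn hps).ne'
  have hpow : e ^ p ^ s = ambMk F (n * p ^ s) (lamAdd F α β) (C DualNumber.eps) *
      ambMk F (n * p ^ s) (lamAdd F α β) (C (algebraMap F (DualNumber F) β)) := by
    rw [he, ← map_pow, ← Polynomial.map_pow, X_pow_sub_C_pow_char_pow, hα₀, ambMk_map_X_pow_sub_C]
  have hβu : IsUnit (ambMk F (n * p ^ s) (lamAdd F α β) (C (algebraMap F (DualNumber F) β))) :=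
    (((isUnit_iff_ne_zero.2 hβ).map (algebraMap F (DualNumber F))).map C).map _
  have hzero : e ^ (2 * p ^ s) = 0 := by
    rw [mul_comm 2 (p ^ s), pow_mul, hpow, mul_pow, ← map_pow, ← C_pow]
    simp [pow_two]
  have hne : e ^ (2 * p ^ s - 1) ≠ 0 := by
    rw [show 2 * p ^ s - 1 = p ^ s + (p ^ s - 1) by omega, pow_add, hpow, mul_right_comm, Ne,
      hβu.mul_left_eq_zero, he, ← map_pow, ← Polynomial.map_pow, ← map_mul]
    refine ambMk_C_eps_mul_map_ne_zero hN ((monic_X_pow_sub_C α₀ hn.ne').pow _) ?_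
    rw [(monic_X_pow_sub_C α₀ hn.ne').natDegree_pow, natDegree_X_pow_sub_C, mul_comm]
    exact Nat.mul_lt_mul_of_pos_left (by omega) hn
  have heps : e ∣ ambMk F (n * p ^ s) (lamAdd F α β) (C DualNumber.eps) :=
    hβu.dvd_mul_right.1 (hpow ▸ dvd_pow_self e hps.ne')
  have hnil : IsNilpotent e := ⟨_, hzero⟩
  have hdvd : ∀ a, e ∣ a ∨ IsUnit a := by
    subst he
    exact ambMk_dvd_or_isUnit hirr hnil heps
  have hnu : ¬ IsUnit e := fun hu => by
    have h0 := hzero ▸ hu.pow (2 * p ^ s)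
    exact hne (by rw [← mul_one (e ^ _), ← isUnit_zero_iff.1 h0, mul_zero])
  have hmax := isMaximal_span_of_dvd_or_isUnit hnu hdvd
  have hall := exists_eq_span_pow_of_dvd_or_isUnit hzero hdvd
  refine ⟨fun I J => ?_, hmax, fun I hI => eq_span_of_isMaximal hnil hmax hI, hall,
    fun i j _ hj hij => span_pow_lt_span_pow hzero hne hj hij, by simp [hzero]⟩
  obtain ⟨i, -, rfl⟩ := hall I
  obtain ⟨j, -, rfl⟩ := hall J
  simp only [Ideal.span_singleton_le_span_singleton]
  exact (le_total j i).imp (pow_dvd_pow e) (pow_dvd_pow e)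
end

section
/- For every integer 0 ≤ i ≤ 2p^s, the ideal ⟨(x^n − α₀)^i⟩ of 𝓡 = R[x]/⟨x^{np^s} − (α + uβ)⟩ has exactly p^{mn(2p^s − i)} elements. -/
open Polynomial

/-- The quotient of `A[x]` by a monic polynomial `g` has `|A| ^ deg g` elements. -/
theorem AdjoinRoot.natCard_of_monic {A : Type*} [CommRing A] {g : A[X]} (hg : g.Monic) :
    Nat.card (AdjoinRoot g) = Nat.card A ^ g.natDegree := by
  rw [Nat.card_congr (AdjoinRoot.powerBasis' hg).basis.equivFun.toEquiv, Nat.card_fun]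
  simp

/-- If the kernel of a surjection `φ` from `K[x]` is generated by `f ^ k` with `f` monic, then the
ideal generated by `φ f ^ i` has `|K| ^ (deg f * (k - i))` elements. -/
theorem Polynomial.natCard_span_pow_of_ker_eq {K A : Type*} [Field K] [CommRing A]
    (φ : K[X] →+* A) (hφ : Function.Surjective φ) {f : K[X]} (hf : f.Monic) {k : ℕ}
    (hker : RingHom.ker φ = Ideal.span {f ^ k}) {i : ℕ} (hi : i ≤ k) :
    Nat.card (Ideal.span {φ f ^ i}) = Nat.card K ^ (f.natDegree * (k - i)) := by
  let ψ : K[X] →+ Ideal.span {φ f ^ i} :=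
    { toFun := fun g => ⟨φ g * φ f ^ i, Ideal.mul_mem_left _ _ (Ideal.mem_span_singleton_self _)⟩
      map_zero' := by ext; simp
      map_add' := fun a b => by ext; simp [add_mul] }
  have hψ : Function.Surjective ψ := by
    rintro ⟨y, hy⟩
    obtain ⟨a, rfl⟩ := Ideal.mem_span_singleton'.mp hy
    obtain ⟨g, rfl⟩ := hφ a
    exact ⟨g, rfl⟩
  have hkerψ : ψ.ker = (Ideal.span {f ^ (k - i)}).toAddSubgroup := by
    ext g
    have h : ψ g = 0 ↔ g * f ^ i ∈ RingHom.ker φ := by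
      rw [RingHom.mem_ker, map_mul, map_pow, Subtype.ext_iff]
      rfl
    rw [AddMonoidHom.mem_ker, h, hker, Ideal.mem_span_singleton, Submodule.mem_toAddSubgroup,
      Ideal.mem_span_singleton]
    conv_lhs => rw [← Nat.sub_add_cancel hi, pow_add]
    exact mul_dvd_mul_iff_right (pow_ne_zero _ hf.ne_zero)
  rw [← Nat.card_congr (QuotientAddGroup.quotientKerEquivOfSurjective ψ hψ).toEquiv, hkerψ]
  refine (AdjoinRoot.natCard_of_monic (hf.pow (k - i))).trans ?_
  rw [hf.natDegree_pow, mul_comm]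

/-- A surjection from `K[x]` onto a ring with `|K| ^ deg g` elements which kills a monic `g` has
kernel generated by `g`. -/
theorem Polynomial.ker_eq_span_of_natCard_eq {K A : Type*} [Field K] [Finite K] [CommRing A]
    (φ : K[X] →+* A) (hφ : Function.Surjective φ) {g : K[X]} (hg : g.Monic) (hφg : φ g = 0)
    (hA : Nat.card A = Nat.card K ^ g.natDegree) :
    RingHom.ker φ = Ideal.span {g} := by
  have hle : ∀ a ∈ Ideal.span {g}, φ a = 0 := by
    intro a ha
    obtain ⟨b, rfl⟩ := Ideal.mem_span_singleton'.mp ha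
    rw [map_mul, hφg, mul_zero]
  have hcard : Nat.card (K[X] ⧸ Ideal.span {g}) = Nat.card A :=
    (AdjoinRoot.natCard_of_monic hg).trans hA.symm
  have : Finite (K[X] ⧸ Ideal.span {g}) := by
    refine Nat.finite_of_card_ne_zero ?_
    rw [hcard, hA]
    exact pow_ne_zero _ Nat.card_pos.ne'
  have hbij := (Nat.bijective_iff_surjective_and_card (Ideal.Quotient.lift _ φ hle)).mpr
    ⟨Ideal.Quotient.lift_surjective_of_surjective _ hle hφ, hcard⟩
  refine le_antisymm (fun a ha => ?_) hle
  rw [← Ideal.Quotient.eq_zero_iff_mem]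
  refine hbij.1 ?_
  rw [Ideal.Quotient.lift_mk, map_zero]
  exact ha

/-- If `x^n - α₀` is irreducible in `F[x]`, then for every `0 ≤ i ≤ 2p^s`
the ideal `⟨(x^n - α₀)^i⟩` of `𝓡 = R[x]/⟨x^{np^s} - (α + uβ)⟩` has exactly
`p^{mn(2p^s − i)}` elements. -/
theorem stmt_3 (p m n s : ℕ) (hp : p.Prime) (hm : 0 < m) (hn : 0 < n) (hs : 0 < s)
    (hnp : Nat.gcd n p = 1)
    (F : Type) [Field F] [Fintype F] (hF : Fintype.card F = p ^ m)
    (α β α₀ : F) (hα : α ≠ 0) (hβ : β ≠ 0) (hα₀ : α₀ ^ p ^ s = α)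
    (hirr : Irreducible ((X : F[X]) ^ n - C α₀)) :
    ∀ i ≤ 2 * p ^ s,
      Nat.card (Ideal.span {ambMk F (n * p ^ s) (lamAdd F α β)
          ((X ^ n - C α₀ : F[X]).map (algebraMap F (DualNumber F))) ^ i}) =
        p ^ (m * n * (2 * p ^ s - i)) := by
  intro i hi
  have := Fact.mk hp
  have hK : Nat.card F = p ^ m := by rw [Nat.card_eq_fintype_card, hF]
  have hchar : CharP F p := by
    obtain ⟨q, hq⟩ := CharP.exists F
    obtain ⟨k, hqp, hk⟩ := FiniteField.card F q
    have hpq : p ∣ q := hp.dvd_of_dvd_pow (hk ▸ hF ▸ dvd_pow_self p hm.ne')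
    rwa [(Nat.prime_dvd_prime_iff_eq hp hqp).mp hpq]
  set f : F[X] := X ^ n - C α₀ with hf_def
  have hf : f.Monic := monic_X_pow_sub_C _ hn.ne'
  have hdeg : f.natDegree = n := natDegree_X_pow_sub_C
  let l := lamAdd F α β
  let N := n * p ^ s
  have hN : N ≠ 0 := mul_ne_zero hn.ne' (pow_ne_zero _ hp.ne_zero)
  let φ : F[X] →+* Amb F N l := (ambMk F N l).comp (mapRingHom (algebraMap F (DualNumber F)))
  have hfp : f ^ p ^ s = X ^ N - C α := by
    rw [hf_def, sub_pow_char_pow, ← pow_mul, ← C_pow, hα₀]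
  have hφC : ∀ a : F, φ (C a) = ambMk F N l (C (algebraMap F (DualNumber F) a)) := fun a => by
    simp [φ]
  have hφX : φ X = ambMk F N l X := by simp [φ]
  have hroot : ambMk F N l X ^ N = ambMk F N l (C l) := by
    rw [← sub_eq_zero, ← map_pow, ← map_sub]
    exact AdjoinRoot.mk_self
  have hφf : φ (f ^ p ^ s) =
      ambMk F N l (C DualNumber.eps) * φ (C β) := by
    rw [hfp, map_sub, map_pow, hφX, hroot, hφC, hφC, ← map_sub, ← C_sub, ← map_mul, ← C_mul]
    simp [l, lamAdd]
  have heps : φ (f ^ p ^ s * C β⁻¹) = ambMk F N l (C DualNumber.eps) := by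
    rw [map_mul, hφf, mul_assoc, ← map_mul, ← C_mul, mul_inv_cancel₀ hβ]
    simp
  have hsurj : Function.Surjective φ := by
    rw [← RingHom.range_eq_top, eq_top_iff]
    rintro y -
    obtain ⟨g, rfl⟩ := AdjoinRoot.mk_surjective y
    induction g using Polynomial.induction_on' with
    | add a b ha hb => rw [map_add]; exact add_mem ha hb
    | monomial k a =>
      have ha : a = algebraMap F (DualNumber F) a.fst +
          DualNumber.eps * algebraMap F (DualNumber F) a.snd := by
        ext <;> simp [TrivSqZeroExt.algebraMap_eq_inl]
      refine ⟨(C a.fst + f ^ p ^ s * C β⁻¹ * C a.snd) * X ^ k, ?_⟩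
      rw [← C_mul_X_pow_eq_monomial, map_mul, map_add, map_mul φ _ (C a.snd), heps, hφC, hφC,
        map_pow, hφX]
      conv_rhs => rw [ha]
      simp only [map_add, map_mul, map_pow]
  have hzero : φ (f ^ (2 * p ^ s)) = 0 := by
    rw [mul_comm 2, pow_mul f, map_pow, hφf, mul_pow, ← map_pow, ← C_pow, pow_two DualNumber.eps,
      DualNumber.eps_mul_eps]
    simp
  have hcardR : Nat.card (DualNumber F) = Nat.card F ^ 2 := by
    rw [pow_two]
    exact Nat.card_prod F F
  have hcardA : Nat.card (Amb F N l) = Nat.card F ^ (f ^ (2 * p ^ s)).natDegree := by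
    rw [AdjoinRoot.natCard_of_monic (monic_X_pow_sub_C l hN), natDegree_X_pow_sub_C, hcardR,
      hf.natDegree_pow, hdeg, ← pow_mul]
    congr 1
    ring
  have hker := Polynomial.ker_eq_span_of_natCard_eq φ hsurj (hf.pow _) hzero hcardA
  refine (Polynomial.natCard_span_pow_of_ker_eq φ hsurj hf hker hi).trans ?_
  rw [hK, hdeg, ← pow_mul, mul_assoc]
end

section
/- Let 0 ≤ i ≤ 2p^s and let C ⊆ R^{np^s} be the code corresponding to the ideal ⟨(x^n − α₀)^i⟩ of 𝓡 = R[x]/⟨x^{np^s} − (α + uβ)⟩. Then the dual code C^⊥ equals the code corresponding to the ideal ⟨(x^n − α₀^{-1})^{2p^s − i}⟩ of R[x]/⟨x^{np^s} − (α^{-1} − uα^{-2}β)⟩ (note α^{-1} − uα^{-2}β = (α + uβ)^{-1} in R). -/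
open Polynomial

/-- The polynomial `∑ c_i x^i` associated with a vector `c ∈ R^N`. -/
noncomputable def toPoly {A : Type} [CommRing A] {N : ℕ} (c : Fin N → A) : A[X] :=
  ∑ i, Polynomial.C (c i) * X ^ (i : ℕ)

/-- The code in `R^N` corresponding to an ideal `I` of `R[x]/⟨x^N − l⟩`: the set of
coefficient vectors `c ∈ R^N` (coefficients of the unique representative of degree `< N`)
whose associated polynomial class lies in `I`. -/
noncomputable def codeOf (F : Type) [Field F] (N : ℕ) (l : DualNumber F)
    (I : Ideal (Amb F N l)) : Set (Fin N → DualNumber F) :=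
  {c | ambMk F N l (toPoly c) ∈ I}

/-- The dual code `C^⊥ = {a ∈ R^N | a·b = 0 for all b ∈ C}`, where `a·b = ∑ aᵢbᵢ`. -/
def dualCode {A : Type} [CommRing A] {N : ℕ} (S : Set (Fin N → A)) : Set (Fin N → A) :=
  {a | ∀ b ∈ S, ∑ i, a i * b i = 0}

/-- `(α + uβ)⁻¹ = α⁻¹ − u α⁻² β` as an element of `R = F + uF = DualNumber F`. -/
noncomputable def lamInv (F : Type) [Field F] (α β : F) : DualNumber F :=
  algebraMap F (DualNumber F) α⁻¹ - DualNumber.eps * algebraMap F (DualNumber F) (α⁻¹ ^ 2 * β)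

section Reciprocal

variable {A : Type} [CommRing A] {N : ℕ} {l l' : A}

/-- The inverse of the class of `x` in `A[x]/⟨x^N − l⟩`, where `l'` is the inverse of `l`. -/
noncomputable def invRoot (N : ℕ) (l l' : A) : AdjoinRoot (X ^ N - C l) :=
  AdjoinRoot.of _ l' * AdjoinRoot.root _ ^ (N - 1)

lemma root_pow_eq_of (N : ℕ) (l : A) :
    AdjoinRoot.root (X ^ N - C l) ^ N = AdjoinRoot.of _ l := by
  rw [← AdjoinRoot.mk_X, ← AdjoinRoot.mk_C, ← map_pow, AdjoinRoot.mk_eq_mk]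

lemma root_mul_invRoot (hN : 0 < N) (hl : l * l' = 1) :
    AdjoinRoot.root _ * invRoot N l l' = 1 := by
  obtain ⟨k, rfl⟩ : ∃ k, N = k + 1 := ⟨N - 1, by omega⟩
  rw [invRoot, mul_left_comm, Nat.add_sub_cancel, ← pow_succ', root_pow_eq_of, ← map_mul,
    mul_comm, hl, map_one]

lemma invRoot_pow_eq_of (hN : 0 < N) (hl : l * l' = 1) :
    invRoot N l l' ^ N = AdjoinRoot.of _ l' := by
  have h : AdjoinRoot.of (X ^ N - C l) l * invRoot N l l' ^ N = 1 := by
    rw [← root_pow_eq_of, ← mul_pow, root_mul_invRoot hN hl, one_pow]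
  calc invRoot N l l' ^ N
      = AdjoinRoot.of _ (l * l') * invRoot N l l' ^ N := by rw [hl, map_one, one_mul]
    _ = AdjoinRoot.of _ l' * (AdjoinRoot.of _ l * invRoot N l l' ^ N) := by rw [map_mul]; ring
    _ = AdjoinRoot.of _ l' := by rw [h, mul_one]

/-- The homomorphism `A[x]/⟨x^N − l⁻¹⟩ → A[x]/⟨x^N − l⟩` sending `x` to `x⁻¹`. -/
noncomputable def reciprocalHom (hN : 0 < N) (hl : l * l' = 1) :
    AdjoinRoot (X ^ N - C l') →+* AdjoinRoot (X ^ N - C l) :=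
  AdjoinRoot.lift (AdjoinRoot.of _) (invRoot N l l')
    (by simp [invRoot_pow_eq_of hN hl])

lemma reciprocalHom_root (hN : 0 < N) (hl : l * l' = 1) :
    reciprocalHom hN hl (AdjoinRoot.root _) = invRoot N l l' :=
  AdjoinRoot.lift_root _

lemma reciprocalHom_of (hN : 0 < N) (hl : l * l' = 1) (a : A) :
    reciprocalHom hN hl (AdjoinRoot.of _ a) = AdjoinRoot.of _ a :=
  AdjoinRoot.lift_of _

lemma reciprocalHom_invRoot (hN : 0 < N) (hl : l * l' = 1) (hl' : l' * l = 1) :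
    reciprocalHom hN hl (invRoot N l' l) = AdjoinRoot.root _ := by
  have h := congrArg (reciprocalHom hN hl) (root_mul_invRoot hN hl')
  rw [map_mul, map_one, reciprocalHom_root] at h
  calc _ = (AdjoinRoot.root _ * invRoot N l l') * reciprocalHom hN hl (invRoot N l' l) := by
        rw [root_mul_invRoot hN hl, one_mul]
    _ = _ := by rw [mul_assoc, h, mul_one]

lemma reciprocalHom_reciprocalHom (hN : 0 < N) (hl : l * l' = 1) (hl' : l' * l = 1)
    (z : AdjoinRoot (X ^ N - C l)) :
    reciprocalHom hN hl (reciprocalHom hN hl' z) = z := by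
  have h : (reciprocalHom hN hl).comp (reciprocalHom hN hl') = RingHom.id _ := by
    refine Ideal.Quotient.ringHom_ext (Polynomial.ringHom_ext (fun a => ?_) ?_)
    · change reciprocalHom hN hl (reciprocalHom hN hl' (AdjoinRoot.of _ a)) = AdjoinRoot.of _ a
      rw [reciprocalHom_of, reciprocalHom_of]
    · change reciprocalHom hN hl (reciprocalHom hN hl' (AdjoinRoot.root _)) = AdjoinRoot.root _
      rw [reciprocalHom_root, reciprocalHom_invRoot hN hl hl']
  exact RingHom.congr_fun h z

/-- The constant coefficient of the representative of degree `< N`. -/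
noncomputable def constCoeff (hN : 0 < N) (l : A) : AdjoinRoot (X ^ N - C l) →ₗ[A] A :=
  lcoeff A 0 ∘ₗ AdjoinRoot.modByMonicHom (monic_X_pow_sub_C l hN.ne')

lemma constCoeff_root_pow [Nontrivial A] (hN : 0 < N) (l : A) {k : ℕ} (hk : k < N) :
    constCoeff hN l (AdjoinRoot.root _ ^ k) = if k = 0 then 1 else 0 := by
  have hm := monic_X_pow_sub_C l hN.ne'
  have h : (X ^ k : A[X]) %ₘ (X ^ N - C l) = X ^ k := by
    rw [modByMonic_eq_self_iff hm, degree_X_pow, degree_X_pow_sub_C hN]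
    exact_mod_cast hk
  rw [constCoeff, LinearMap.comp_apply, ← AdjoinRoot.mk_X, ← map_pow,
    AdjoinRoot.modByMonicHom_mk, h, lcoeff_apply, coeff_X_pow]
  simp [eq_comm]

lemma invRoot_pow_mul_root_pow_add (hN : 0 < N) (hl : l * l' = 1) (i k : ℕ) :
    invRoot N l l' ^ i * AdjoinRoot.root _ ^ (i + k) = AdjoinRoot.root _ ^ k := by
  rw [pow_add, ← mul_assoc, ← mul_pow, mul_comm (invRoot N l l'), root_mul_invRoot hN hl,
    one_pow, one_mul]

lemma constCoeff_invRoot_pow_mul_root_pow [Nontrivial A] (hN : 0 < N) (hl : l * l' = 1)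
    {i j : ℕ} (hi : i < N) (hj : j < N) :
    constCoeff hN l (invRoot N l l' ^ i * AdjoinRoot.root _ ^ j) = if i = j then 1 else 0 := by
  rcases le_or_gt i j with h | h
  · obtain ⟨k, rfl⟩ := Nat.exists_eq_add_of_le h
    rw [invRoot_pow_mul_root_pow_add hN hl, constCoeff_root_pow hN l (by omega)]
    simp
  · have e : invRoot N l l' ^ i * AdjoinRoot.root _ ^ j
        = l' • AdjoinRoot.root (X ^ N - C l) ^ (N + j - i) := by
      rw [← invRoot_pow_mul_root_pow_add hN hl i (N + j - i), Nat.add_sub_cancel' (by omega),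
        pow_add, root_pow_eq_of, Algebra.smul_def, AdjoinRoot.algebraMap_eq]
      calc _ = AdjoinRoot.of _ (l * l') * (invRoot N l l' ^ i * AdjoinRoot.root _ ^ j) := by
            rw [hl, map_one, one_mul]
        _ = _ := by rw [map_mul]; ring
    rw [e, map_smul, constCoeff_root_pow hN l (by omega), if_neg (by omega), if_neg (by omega),
      smul_zero]

lemma mk_toPoly (g : A[X]) (c : Fin N → A) :
    AdjoinRoot.mk g (toPoly c) = ∑ i, c i • AdjoinRoot.root g ^ (i : ℕ) := by
  simp [toPoly, Algebra.smul_def]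

lemma exists_mk_toPoly_eq [Nontrivial A] (hN : 0 < N) (l : A) (z : AdjoinRoot (X ^ N - C l)) :
    ∃ c : Fin N → A, AdjoinRoot.mk _ (toPoly c) = z := by
  obtain ⟨g, rfl⟩ := AdjoinRoot.mk_surjective z
  have hm := monic_X_pow_sub_C l hN.ne'
  refine ⟨fun i => (g %ₘ (X ^ N - C l)).coeff i, ?_⟩
  have hd : (g %ₘ (X ^ N - C l)).natDegree < N := by
    have := natDegree_modByMonic_lt g hm (fun h => by
      have := congrArg natDegree h
      rw [natDegree_X_pow_sub_C, natDegree_one] at this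
      omega)
    rwa [natDegree_X_pow_sub_C] at this
  have h : toPoly (fun i : Fin N => (g %ₘ (X ^ N - C l)).coeff i) = g %ₘ (X ^ N - C l) := by
    conv_rhs => rw [as_sum_range_C_mul_X_pow' _ hd]
    exact Fin.sum_univ_eq_sum_range (fun i => C ((g %ₘ (X ^ N - C l)).coeff i) * X ^ i) N
  rw [h]
  exact AdjoinRoot.mk_leftInverse hm (AdjoinRoot.mk _ g)

lemma constCoeff_reciprocalHom_mul [Nontrivial A] (hN : 0 < N) (hl : l * l' = 1)
    (a b : Fin N → A) :
    constCoeff hN l (reciprocalHom hN hl (AdjoinRoot.mk _ (toPoly a)) *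
      AdjoinRoot.mk _ (toPoly b)) = ∑ i, a i * b i := by
  have h : reciprocalHom hN hl (AdjoinRoot.mk _ (toPoly a)) =
      ∑ i, a i • invRoot N l l' ^ (i : ℕ) := by
    simp [mk_toPoly, Algebra.smul_def, reciprocalHom_of, reciprocalHom_root]
  rw [h, mk_toPoly]
  simp [Finset.sum_mul_sum, constCoeff_invRoot_pow_mul_root_pow hN hl, Fin.val_inj, mul_comm]

lemma eq_zero_of_constCoeff_mul_eq_zero [Nontrivial A] (hN : 0 < N) (hl : l * l' = 1)
    {z : AdjoinRoot (X ^ N - C l)} (h : ∀ w, constCoeff hN l (w * z) = 0) : z = 0 := by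
  obtain ⟨b, rfl⟩ := exists_mk_toPoly_eq hN l z
  have hb : b = 0 := by
    ext i
    simpa [Pi.single_apply] using
      (constCoeff_reciprocalHom_mul hN hl (Pi.single i 1) b).symm.trans (h _)
  simp [hb, toPoly]

/-- The dual of the code of an ideal `I` is the code of the reciprocal of the annihilator
of `I`. -/
lemma mem_dualCode_iff [Nontrivial A] (hN : 0 < N) (hl : l * l' = 1)
    (I : Ideal (AdjoinRoot (X ^ N - C l))) (a : Fin N → A) :
    a ∈ dualCode {c : Fin N → A | AdjoinRoot.mk (X ^ N - C l) (toPoly c) ∈ I} ↔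
      ∀ w ∈ I, reciprocalHom hN hl (AdjoinRoot.mk _ (toPoly a)) * w = 0 := by
  constructor
  · intro ha w hw
    refine eq_zero_of_constCoeff_mul_eq_zero hN hl fun v => ?_
    obtain ⟨b, hb⟩ := exists_mk_toPoly_eq hN l (v * w)
    rw [mul_left_comm, ← hb, constCoeff_reciprocalHom_mul]
    exact ha b (by simpa [hb] using I.mul_mem_left v hw)
  · intro h b hb
    rw [← constCoeff_reciprocalHom_mul hN hl, h _ hb, map_zero]

end Reciprocal

section ChainRing

variable {F : Type} [Field F]

lemma lamAdd_mul_lamInv {α : F} (hα : α ≠ 0) (β : F) :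
    lamAdd F α β * lamInv F α β = 1 := by
  have h : (DualNumber.eps : DualNumber F) * DualNumber.eps = 0 := DualNumber.eps_mul_eps
  have e : algebraMap F (DualNumber F) α * algebraMap F (DualNumber F) α⁻¹ = 1 := by
    rw [← map_mul, mul_inv_cancel₀ hα, map_one]
  simp only [lamAdd, lamInv, map_mul, map_pow]
  linear_combination (1 - DualNumber.eps * algebraMap F (DualNumber F) β *
    algebraMap F (DualNumber F) α⁻¹) * e - algebraMap F (DualNumber F) β ^ 2 *
    algebraMap F (DualNumber F) α⁻¹ ^ 2 * h

/-- The natural map `F[x] → R[x]/⟨x^N − (α + uβ)⟩`. -/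
noncomputable def ambOfField (N : ℕ) (l : DualNumber F) : F[X] →+* Amb F N l :=
  (ambMk F N l).comp (mapRingHom (algebraMap F (DualNumber F)))

lemma ambOfField_X_pow_sub_C (N : ℕ) (α β : F) :
    ambOfField N (lamAdd F α β) (X ^ N - C α) =
      AdjoinRoot.of _ (DualNumber.eps * algebraMap F (DualNumber F) β) := by
  have h : AdjoinRoot.root (X ^ N - C (lamAdd F α β)) ^ N =
      AdjoinRoot.of _ (algebraMap F (DualNumber F) α) +
        AdjoinRoot.of _ (DualNumber.eps * algebraMap F (DualNumber F) β) := by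
    rw [root_pow_eq_of, ← map_add, lamAdd]
  rw [← add_sub_cancel_left (AdjoinRoot.of _ (algebraMap F (DualNumber F) α))
    (AdjoinRoot.of _ (DualNumber.eps * algebraMap F (DualNumber F) β)), ← h]
  simp [ambOfField]

lemma ambOfField_surjective (N : ℕ) (α : F) {β : F} (hβ : β ≠ 0) :
    Function.Surjective (ambOfField N (lamAdd F α β)) := by
  have hR (r : DualNumber F) : AdjoinRoot.of _ r ∈ (ambOfField N (lamAdd F α β)).range := by
    refine ⟨C r.fst + C (r.snd * β⁻¹) * (X ^ N - C α), ?_⟩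
    rw [map_add, map_mul, ambOfField_X_pow_sub_C]
    have h (c : F) : ambOfField N (lamAdd F α β) (C c) =
        AdjoinRoot.of _ (algebraMap F (DualNumber F) c) := by
      simp [ambOfField]
    rw [h, h, ← map_mul, ← map_add]
    congr 1
    ext <;> simp [hβ, TrivSqZeroExt.algebraMap_eq_inl]
  intro z
  obtain ⟨g, rfl⟩ := AdjoinRoot.mk_surjective z
  change AdjoinRoot.mk _ g ∈ (ambOfField N (lamAdd F α β)).range
  induction g using Polynomial.induction_on' with
  | add p q hp hq => rw [map_add]; exact add_mem hp hq
  | monomial k a =>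
    rw [← C_mul_X_pow_eq_monomial, map_mul, map_pow]
    exact mul_mem (hR a) (pow_mem (RingHom.mem_range.2 ⟨X, by simp [ambOfField]⟩) k)

lemma sq_dvd_of_ambOfField_eq_zero (N : ℕ) (α : F) {β : F} (hβ : β ≠ 0) {g : F[X]}
    (hg : ambOfField N (lamAdd F α β) g = 0) : (X ^ N - C α) ^ 2 ∣ g := by
  set P : F[X] := X ^ N - C α with hP
  let e : AdjoinRoot (P ^ 2) := AdjoinRoot.mk _ (C β⁻¹ * P)
  have he : e * e = 0 := by
    rw [← map_mul, AdjoinRoot.mk_eq_zero]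
    exact ⟨C β⁻¹ ^ 2, by ring⟩
  let ψ : DualNumber F →ₐ[F] AdjoinRoot (P ^ 2) :=
    DualNumber.lift ⟨(Algebra.ofId F _, e), he, fun _ => Commute.all _ _⟩
  have hψe : ψ DualNumber.eps = e := DualNumber.lift_apply_eps _
  have hψ (c : F) : ψ (algebraMap F _ c) = AdjoinRoot.of _ c := ψ.commutes c
  have hl : ψ (lamAdd F α β) = AdjoinRoot.root (P ^ 2) ^ N := by
    rw [lamAdd, map_add, map_mul, hψ, hψ, hψe, ← AdjoinRoot.mk_C, ← AdjoinRoot.mk_C,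
      ← map_mul, ← map_add, ← AdjoinRoot.mk_X, ← map_pow]
    congr 1
    have : C β⁻¹ * C β = 1 := by rw [← C_mul, inv_mul_cancel₀ hβ, C_1]
    rw [hP]
    linear_combination (X ^ N - C α) * this
  have h0 : (X ^ N - C (lamAdd F α β)).eval₂ ψ.toRingHom (AdjoinRoot.root (P ^ 2)) = 0 := by
    rw [eval₂_sub, eval₂_X_pow, eval₂_C]
    exact sub_eq_zero.2 hl.symm
  have h1 : AdjoinRoot.lift ψ.toRingHom _ h0 (ambOfField N (lamAdd F α β) g) =
      AdjoinRoot.mk _ g := by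
    have hc : ψ.toRingHom.comp (algebraMap F (DualNumber F)) = AdjoinRoot.of (P ^ 2) :=
      RingHom.ext hψ
    change AdjoinRoot.lift ψ.toRingHom _ h0 (AdjoinRoot.mk _ (g.map _)) = _
    rw [AdjoinRoot.lift_mk, eval₂_map, hc]
    exact AdjoinRoot.aeval_eq g
  rw [hg, map_zero] at h1
  exact AdjoinRoot.mk_eq_zero.1 h1.symm

lemma ambOfField_eq_zero_iff (N : ℕ) (α : F) {β : F} (hβ : β ≠ 0) {g : F[X]} :
    ambOfField N (lamAdd F α β) g = 0 ↔ (X ^ N - C α) ^ 2 ∣ g := by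
  refine ⟨sq_dvd_of_ambOfField_eq_zero N α hβ, ?_⟩
  rintro ⟨k, rfl⟩
  rw [map_mul, map_pow, ambOfField_X_pow_sub_C, ← map_pow, mul_pow, sq DualNumber.eps,
    DualNumber.eps_mul_eps, zero_mul, map_zero, zero_mul]

/-- Multiplication by `f ^ i` kills exactly the multiples of `f ^ (k - i)` when
`f ^ k = (x ^ N - α) ^ 2`. -/
lemma mul_ambOfField_pow_eq_zero_iff (N : ℕ) (α : F) {β : F} (hβ : β ≠ 0) {f : F[X]}
    (hf : f ≠ 0) {i k : ℕ} (hfk : f ^ k = (X ^ N - C α) ^ 2) (hi : i ≤ k)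
    (z : Amb F N (lamAdd F α β)) :
    z * ambOfField N (lamAdd F α β) f ^ i = 0 ↔
      ambOfField N (lamAdd F α β) f ^ (k - i) ∣ z := by
  have hk : f ^ k = f ^ (k - i) * f ^ i := by rw [← pow_add, Nat.sub_add_cancel hi]
  constructor
  · obtain ⟨g, rfl⟩ := ambOfField_surjective N α hβ z
    rw [← map_pow, ← map_pow, ← map_mul, ambOfField_eq_zero_iff N α hβ, ← hfk, hk]
    exact fun h => map_dvd _ ((mul_dvd_mul_iff_right (pow_ne_zero i hf)).1 h)
  · rintro ⟨w, rfl⟩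
    rw [mul_right_comm, ← pow_add, Nat.sub_add_cancel hi, ← map_pow,
      (ambOfField_eq_zero_iff N α hβ).2 hfk.symm.dvd, zero_mul]

lemma associated_reciprocalHom_ambOfField {N n : ℕ} (hN : 0 < N) {l l' : DualNumber F}
    (hl : l * l' = 1) {a : F} (ha : a ≠ 0) :
    Associated (reciprocalHom hN hl (ambOfField N l' (X ^ n - C a⁻¹)))
      (ambOfField N l (X ^ n - C a)) := by
  have hu : IsUnit (AdjoinRoot.of (X ^ N - C l) (algebraMap F (DualNumber F) (-a)) *
      AdjoinRoot.root _ ^ n) :=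
    (((IsUnit.mk0 _ (neg_ne_zero.2 ha)).map _).map _).mul
      ((IsUnit.of_mul_eq_one _ (root_mul_invRoot hN hl)).pow n)
  refine ⟨hu.unit, ?_⟩
  have h1 : AdjoinRoot.root _ ^ n * invRoot N l l' ^ n = 1 := by
    rw [← mul_pow, root_mul_invRoot hN hl, one_pow]
  have h2 : AdjoinRoot.of (X ^ N - C l) (algebraMap F (DualNumber F) a) *
      AdjoinRoot.of (X ^ N - C l) (algebraMap F (DualNumber F) a⁻¹) = 1 := by
    rw [← map_mul, ← map_mul, mul_inv_cancel₀ ha, map_one, map_one]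
  have h3 : reciprocalHom hN hl (ambOfField N l' (X ^ n - C a⁻¹)) =
      invRoot N l l' ^ n - AdjoinRoot.of _ (algebraMap F (DualNumber F) a⁻¹) := by
    rw [← reciprocalHom_root hN hl, ← reciprocalHom_of hN hl, ← map_pow, ← map_sub]
    simp [ambOfField]
  have h4 : ambOfField N l (X ^ n - C a) =
      AdjoinRoot.root _ ^ n - AdjoinRoot.of _ (algebraMap F (DualNumber F) a) := by
    simp [ambOfField]
  rw [h3, h4, IsUnit.unit_spec, map_neg, map_neg]
  linear_combination -AdjoinRoot.of (X ^ N - C l) (algebraMap F (DualNumber F) a) * h1 +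
    AdjoinRoot.root (X ^ N - C l) ^ n * h2

end ChainRing

/-- Assume `x^n - α₀` is irreducible in `F[x]`. For `0 ≤ i ≤ 2p^s`, let
`C ⊆ R^{np^s}` be the code corresponding to the ideal `⟨(x^n - α₀)^i⟩` of
`𝓡 = R[x]/⟨x^{np^s} - (α + uβ)⟩`. Then the dual code `C^⊥` equals the code corresponding to
the ideal `⟨(x^n - α₀⁻¹)^{2p^s − i}⟩` of `R[x]/⟨x^{np^s} - (α⁻¹ - uα⁻²β)⟩`
(note `α⁻¹ - uα⁻²β = (α + uβ)⁻¹` in `R`). -/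
theorem stmt_4 (p m n s : ℕ) (hp : p.Prime) (hm : 0 < m) (hn : 0 < n) (hs : 0 < s)
    (hnp : Nat.gcd n p = 1)
    (F : Type) [Field F] [Fintype F] (hF : Fintype.card F = p ^ m)
    (α β α₀ : F) (hα : α ≠ 0) (hβ : β ≠ 0) (hα₀ : α₀ ^ p ^ s = α)
    (hirr : Irreducible ((X : F[X]) ^ n - C α₀)) :
    ∀ i ≤ 2 * p ^ s,
      dualCode (codeOf F (n * p ^ s) (lamAdd F α β)
          (Ideal.span {ambMk F (n * p ^ s) (lamAdd F α β)
            ((X ^ n - C α₀ : F[X]).map (algebraMap F (DualNumber F))) ^ i})) =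
        codeOf F (n * p ^ s) (lamInv F α β)
          (Ideal.span {ambMk F (n * p ^ s) (lamInv F α β)
            ((X ^ n - C α₀⁻¹ : F[X]).map (algebraMap F (DualNumber F))) ^ (2 * p ^ s - i)}) := by
  intro i hi
  have : Fact p.Prime := ⟨hp⟩
  have hq : 0 < p ^ s := pow_pos hp.pos s
  have hN : 0 < n * p ^ s := Nat.mul_pos hn hq
  have hl := lamAdd_mul_lamInv hα β
  have hl' : lamInv F α β * lamAdd F α β = 1 := by rw [mul_comm, hl]
  have hα₀' : α₀ ≠ 0 := by
    rintro rfl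
    exact hα (by rw [← hα₀, zero_pow hq.ne'])
  have : CharP F p := charP_of_card_eq_prime_pow hF
  have hfk : (X ^ n - C α₀ : F[X]) ^ (2 * p ^ s) = (X ^ (n * p ^ s) - C α) ^ 2 := by
    rw [mul_comm, pow_mul, sub_pow_char_pow, ← pow_mul, ← C_pow, hα₀]
  ext a
  refine (mem_dualCode_iff hN hl _ a).trans ?_
  change _ ↔ ambMk F (n * p ^ s) (lamInv F α β) (toPoly a) ∈
    Ideal.span {ambOfField (n * p ^ s) (lamInv F α β) (X ^ n - C α₀⁻¹) ^ (2 * p ^ s - i)}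
  rw [Ideal.mem_span_singleton]
  have hdvd {x y : Amb F (n * p ^ s) (lamInv F α β)} :
      reciprocalHom hN hl x ∣ reciprocalHom hN hl y ↔ x ∣ y := by
    refine ⟨fun h => ?_, map_dvd _⟩
    simpa only [reciprocalHom_reciprocalHom] using map_dvd (reciprocalHom hN hl') h
  rw [← hdvd, map_pow, ((associated_reciprocalHom_ambOfField hN hl hα₀').pow_pow).dvd_iff_dvd_left,
    ← mul_ambOfField_pow_eq_zero_iff _ α hβ hirr.ne_zero hfk hi]
  refine ⟨fun h => h _ (Ideal.mem_span_singleton_self _), fun h w hw => ?_⟩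
  obtain ⟨v, rfl⟩ := Ideal.mem_span_singleton.1 hw
  rw [← mul_assoc]
  exact mul_eq_zero_of_left h v
end

section
/- Among the ideals ⟨(x^n − α₀)^i⟩ (0 ≤ i ≤ 2p^s) of 𝓡 = R[x]/⟨x^{np^s} − (α + uβ)⟩, viewed as codes in R^{np^s}, the ideal ⟨u⟩ = ⟨(x^n − α₀)^{p^s}⟩ is the unique self-dual one: it satisfies C = C^⊥, and it is the only (α + uβ)-constacyclic code of length np^s over R with this property. -/
open Polynomial

/-- A polynomial over the dual numbers is the lift of its reduction plus a multiple of `ε`. -/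
theorem exists_eq_map_fst_add_eps_mul {F : Type} [Field F] (P : (DualNumber F)[X]) :
    ∃ Q : (DualNumber F)[X],
      P = (P.map (TrivSqZeroExt.fstHom F F F).toRingHom).map (algebraMap F (DualNumber F)) +
        C DualNumber.eps * Q := by
  induction P using Polynomial.induction_on' with
  | add p q hp hq =>
    obtain ⟨a, ha⟩ := hp
    obtain ⟨b, hb⟩ := hq
    refine ⟨a + b, ?_⟩
    rw [Polynomial.map_add, Polynomial.map_add, mul_add]
    nth_rewrite 1 [ha, hb]
    ring
  | monomial k r =>
    refine ⟨monomial k (algebraMap F (DualNumber F) r.snd), ?_⟩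
    rw [map_monomial, map_monomial, C_mul_monomial, ← map_add]
    congr 1
    ext <;> simp [TrivSqZeroExt.algebraMap_eq_inl]

/-- A dual number with vanishing first component is a multiple of `ε`. -/
theorem eq_eps_mul_of_fst_eq_zero {F : Type} [Field F] {r : DualNumber F}
    (h : TrivSqZeroExt.fst r = 0) :
    r = DualNumber.eps * algebraMap F (DualNumber F) (TrivSqZeroExt.snd r) := by
  ext <;> simp [TrivSqZeroExt.algebraMap_eq_inl, h]

theorem degree_toPoly_lt {A : Type} [CommRing A] {N : ℕ} (c : Fin N → A) :
    (toPoly c).degree < N := by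
  rw [toPoly, Finset.sum_fin_eq_sum_range, degree_lt_iff_coeff_zero]
  intro k hk
  rw [finsetSum_coeff]
  refine Finset.sum_eq_zero fun i hi => ?_
  rw [Finset.mem_range] at hi
  rw [dif_pos hi, coeff_C_mul_X_pow, if_neg (by omega)]

theorem coeff_toPoly {A : Type} [CommRing A] {N : ℕ} (c : Fin N → A) (j : Fin N) :
    (toPoly c).coeff j = c j := by
  simp [toPoly, coeff_X_pow, Fin.val_inj]

/-- Every class in `R[x]/⟨x^N − l⟩` has a representative of degree less than `N`. -/
theorem exists_ambMk_toPoly {F : Type} [Field F] {N : ℕ} (hN : N ≠ 0) (l : DualNumber F)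
    (a : Amb F N l) : ∃ c : Fin N → DualNumber F, ambMk F N l (toPoly c) = a := by
  obtain ⟨P, rfl⟩ := AdjoinRoot.mk_surjective a
  have hm : (X ^ N - C l : (DualNumber F)[X]).Monic := monic_X_pow_sub_C l hN
  have hd : (P %ₘ (X ^ N - C l)).degree < N :=
    (degree_modByMonic_lt P hm).trans_eq (degree_X_pow_sub_C (Nat.pos_of_ne_zero hN) l)
  refine ⟨fun i => (P %ₘ (X ^ N - C l)).coeff i, ?_⟩
  have h : toPoly (fun i : Fin N => (P %ₘ (X ^ N - C l)).coeff i) = P %ₘ (X ^ N - C l) := by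
    rw [toPoly, Fin.sum_univ_eq_sum_range fun i => C ((P %ₘ (X ^ N - C l)).coeff i) * X ^ i]
    exact (as_sum_range_C_mul_X_pow' _ (by
      by_cases h0 : P %ₘ (X ^ N - C l) = 0
      · simpa [h0] using Nat.pos_of_ne_zero hN
      · exact (natDegree_lt_iff_degree_lt h0).2 hd)).symm
  rw [h, AdjoinRoot.mk_eq_mk]
  exact ⟨-(P /ₘ (X ^ N - C l)), by linear_combination modByMonic_add_div P (X ^ N - C l)⟩

theorem codeOf_mono {F : Type} [Field F] {N : ℕ} {l : DualNumber F} {I J : Ideal (Amb F N l)}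
    (h : I ≤ J) : codeOf F N l I ⊆ codeOf F N l J :=
  fun _ hc => h hc

theorem codeOf_injective {F : Type} [Field F] {N : ℕ} (hN : N ≠ 0) (l : DualNumber F) :
    Function.Injective (codeOf F N l) := by
  intro I J h
  ext a
  obtain ⟨c, rfl⟩ := exists_ambMk_toPoly hN l a
  exact Set.ext_iff.1 h c

theorem dualCode_anti {A : Type} [CommRing A] {N : ℕ} {S T : Set (Fin N → A)} (h : S ⊆ T) :
    dualCode T ⊆ dualCode S :=
  fun _ ha b hb => ha b (h hb)

/-- The code of `⟨u⟩` consists of the vectors all of whose entries are multiples of `u`. -/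
theorem mem_codeOf_span_eps {F : Type} [Field F] {N : ℕ} (hN : N ≠ 0) (l : DualNumber F)
    (c : Fin N → DualNumber F) :
    c ∈ codeOf F N l (Ideal.span {ambMk F N l (C DualNumber.eps)}) ↔
      ∀ i, TrivSqZeroExt.fst (c i) = 0 := by
  constructor
  · intro hc i
    obtain ⟨a, ha⟩ := Ideal.mem_span_singleton'.1 hc
    obtain ⟨Q, rfl⟩ := AdjoinRoot.mk_surjective a
    rw [← map_mul, AdjoinRoot.mk_eq_mk] at ha
    let φ : DualNumber F →+* F := (TrivSqZeroExt.fstHom F F F).toRingHom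
    have hφ : φ DualNumber.eps = 0 := TrivSqZeroExt.fst_inr F 1
    have hdvd := Polynomial.map_dvd φ ha
    simp only [Polynomial.map_sub, Polynomial.map_mul, Polynomial.map_pow, map_X, map_C, hφ,
      C_0, mul_zero, zero_sub, dvd_neg] at hdvd
    have h0 : (toPoly c).map φ = 0 := by
      refine eq_zero_of_dvd_of_degree_lt hdvd ?_
      rw [degree_X_pow_sub_C (Nat.pos_of_ne_zero hN)]
      exact degree_map_le.trans_lt (degree_toPoly_lt c)
    have hcoeff := congrArg (fun q => q.coeff i) h0
    simp only [coeff_map, coeff_toPoly, coeff_zero] at hcoeff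
    exact hcoeff
  · intro h
    change ambMk F N l (toPoly c) ∈ Ideal.span {ambMk F N l (C DualNumber.eps)}
    rw [toPoly, map_sum]
    refine Ideal.sum_mem _ fun i _ => ?_
    rw [eq_eps_mul_of_fst_eq_zero (h i), C_mul, mul_assoc, map_mul]
    exact Ideal.mul_mem_right _ _ (Ideal.mem_span_singleton_self _)

/-- The code of `⟨u⟩` is self-dual. -/
theorem codeOf_span_eps_eq_dualCode {F : Type} [Field F] {N : ℕ} (hN : N ≠ 0)
    (l : DualNumber F) :
    codeOf F N l (Ideal.span {ambMk F N l (C DualNumber.eps)}) =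
      dualCode (codeOf F N l (Ideal.span {ambMk F N l (C DualNumber.eps)})) := by
  ext a
  rw [mem_codeOf_span_eps hN]
  constructor
  · intro ha b hb
    rw [mem_codeOf_span_eps hN] at hb
    refine Finset.sum_eq_zero fun i _ => ?_
    ext <;> simp [ha i, hb i]
  · intro ha i
    have h := ha (Pi.single i DualNumber.eps) ((mem_codeOf_span_eps hN l _).2 fun j => by
      by_cases hj : j = i
      · subst hj; simp
      · simp [hj])
    have h' : a i * DualNumber.eps = 0 := by simpa [Pi.single_apply] using h
    simpa using congrArg TrivSqZeroExt.snd h'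

/-- A self-dual code coming from an ideal comparable with `⟨u⟩` comes from `⟨u⟩`. -/
theorem eq_span_eps_of_codeOf_eq_dualCode {F : Type} [Field F] {N : ℕ} (hN : N ≠ 0)
    {l : DualNumber F} {I : Ideal (Amb F N l)}
    (hI : I ≤ Ideal.span {ambMk F N l (C DualNumber.eps)} ∨
      Ideal.span {ambMk F N l (C DualNumber.eps)} ≤ I)
    (h : codeOf F N l I = dualCode (codeOf F N l I)) :
    I = Ideal.span {ambMk F N l (C DualNumber.eps)} := by
  have hu := codeOf_span_eps_eq_dualCode hN l
  refine codeOf_injective hN l ?_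
  rcases hI with hI | hI
  · refine (codeOf_mono hI).antisymm ?_
    rw [hu, h]
    exact dualCode_anti (codeOf_mono hI)
  · refine Set.Subset.antisymm ?_ (codeOf_mono hI)
    rw [hu, h]
    exact dualCode_anti (codeOf_mono hI)

/-- If every element of a commutative ring is a unit or a multiple of `f`, every ideal is
comparable with every `⟨f ^ k⟩`. -/
theorem le_span_pow_or_span_pow_le {A : Type*} [CommRing A] {f : A}
    (hf : ∀ a, IsUnit a ∨ f ∣ a) (k : ℕ) (I : Ideal A) :
    I ≤ Ideal.span {f ^ k} ∨ Ideal.span {f ^ k} ≤ I := by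
  induction k with
  | zero => left; simp
  | succ k ih =>
    rcases ih with ih | ih
    · by_cases hI : I ≤ Ideal.span {f ^ (k + 1)}
      · exact Or.inl hI
      obtain ⟨g, hg, hgn⟩ := SetLike.not_le_iff_exists.1 hI
      obtain ⟨a, rfl⟩ := Ideal.mem_span_singleton.1 (ih hg)
      right
      rw [Ideal.span_singleton_le_iff_mem, pow_succ]
      refine I.mul_mem_right _ ?_
      rcases hf a with ha | ⟨b, rfl⟩
      · exact (Ideal.mul_unit_mem_iff_mem I ha).1 hg
      · exact absurd (Ideal.mem_span_singleton.2 ⟨b, by ring⟩) hgn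
    · right
      refine le_trans ?_ ih
      rw [Ideal.span_singleton_le_span_singleton]
      exact pow_dvd_pow f k.le_succ

/-- If `u` is a multiple of a nilpotent class of an irreducible polynomial over `F`, every element
of `R[x]/⟨x^N − l⟩` is a unit or a multiple of that class. -/
theorem isUnit_or_dvd_of_irreducible {F : Type} [Field F] {N : ℕ} {l : DualNumber F} {f : F[X]}
    (hf : Irreducible f)
    (hnil : IsNilpotent (ambMk F N l (f.map (algebraMap F (DualNumber F)))))
    (heps : ambMk F N l (f.map (algebraMap F (DualNumber F))) ∣ ambMk F N l (C DualNumber.eps))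
    (a : Amb F N l) :
    IsUnit a ∨ ambMk F N l (f.map (algebraMap F (DualNumber F))) ∣ a := by
  obtain ⟨P, rfl⟩ := AdjoinRoot.mk_surjective a
  obtain ⟨Q, hQ⟩ := exists_eq_map_fst_add_eps_mul P
  set P₀ := P.map (TrivSqZeroExt.fstHom F F F).toRingHom
  obtain ⟨e, he⟩ := heps
  have hP := congrArg (ambMk F N l) hQ
  rw [map_add, map_mul, he] at hP
  rcases hf.isCoprime_or_dvd P₀ with ⟨b, c, hbc⟩ | ⟨b, hb⟩
  · left
    have h1 := congrArg (fun q => ambMk F N l (q.map (algebraMap F (DualNumber F)))) hbc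
    simp only [Polynomial.map_add, Polynomial.map_mul, Polynomial.map_one, map_add, map_mul,
      map_one] at h1
    set φ := ambMk F N l (f.map (algebraMap F (DualNumber F)))
    set B := ambMk F N l (b.map (algebraMap F (DualNumber F)))
    set K := ambMk F N l (c.map (algebraMap F (DualNumber F)))
    have h2 : K * ambMk F N l P = 1 - φ * (B - K * e * ambMk F N l Q) := by
      linear_combination K * hP + h1
    have h3 : IsUnit (K * ambMk F N l P) := by
      rw [h2]
      exact ((Commute.all _ _).isNilpotent_mul_right hnil).isUnit_one_sub
    exact isUnit_of_mul_isUnit_right h3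
  · right
    rw [hb, Polynomial.map_mul, map_mul] at hP
    exact ⟨_, hP.trans (by rw [mul_assoc, ← mul_add])⟩

/-- In `R[x]/⟨x^{np^s} − (α + uβ)⟩` one has `(x^n − α₀)^{p^s} = uβ`. -/
theorem ambMk_pow_eq {F : Type} [Field F] (p n s : ℕ) [Fact p.Prime] [CharP F p]
    {α β α₀ : F} (hα₀ : α₀ ^ p ^ s = α) :
    ambMk F (n * p ^ s) (lamAdd F α β)
        ((X ^ n - C α₀ : F[X]).map (algebraMap F (DualNumber F))) ^ p ^ s =
      ambMk F (n * p ^ s) (lamAdd F α β) (C DualNumber.eps) *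
        ambMk F (n * p ^ s) (lamAdd F α β) (C (algebraMap F (DualNumber F) β)) := by
  rw [← map_pow, ← Polynomial.map_pow, sub_pow_char_pow, ← map_mul, AdjoinRoot.mk_eq_mk,
    ← pow_mul, ← C_pow, hα₀, ← C_mul]
  refine ⟨1, ?_⟩
  simp only [Polynomial.map_sub, Polynomial.map_pow, map_X, map_C, lamAdd, C_add]
  ring

/-- Assume `x^n - α₀` is irreducible in `F[x]`. In
`𝓡 = R[x]/⟨x^{np^s} - (α + uβ)⟩`, the ideal `⟨u⟩` equals `⟨(x^n - α₀)^{p^s}⟩`, its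
corresponding code in `R^{np^s}` is self-dual (`C = C^⊥`), and it is the unique
`(α + uβ)`-constacyclic code of length `np^s` over `R` (i.e. the unique ideal of `𝓡`)
with this property. -/
theorem stmt_5 (p m n s : ℕ) (hp : p.Prime) (hm : 0 < m) (hn : 0 < n) (hs : 0 < s)
    (hnp : Nat.gcd n p = 1)
    (F : Type) [Field F] [Fintype F] (hF : Fintype.card F = p ^ m)
    (α β α₀ : F) (hα : α ≠ 0) (hβ : β ≠ 0) (hα₀ : α₀ ^ p ^ s = α)
    (hirr : Irreducible ((X : F[X]) ^ n - C α₀)) :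
    Ideal.span {ambMk F (n * p ^ s) (lamAdd F α β) (C DualNumber.eps)} =
      Ideal.span {ambMk F (n * p ^ s) (lamAdd F α β)
        ((X ^ n - C α₀ : F[X]).map (algebraMap F (DualNumber F))) ^ p ^ s} ∧
    codeOf F (n * p ^ s) (lamAdd F α β)
        (Ideal.span {ambMk F (n * p ^ s) (lamAdd F α β) (C DualNumber.eps)}) =
      dualCode (codeOf F (n * p ^ s) (lamAdd F α β)
        (Ideal.span {ambMk F (n * p ^ s) (lamAdd F α β) (C DualNumber.eps)})) ∧
    ∀ I : Ideal (Amb F (n * p ^ s) (lamAdd F α β)),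
      codeOf F (n * p ^ s) (lamAdd F α β) I = dualCode (codeOf F (n * p ^ s) (lamAdd F α β) I) →
      I = Ideal.span {ambMk F (n * p ^ s) (lamAdd F α β) (C DualNumber.eps)} := by
  have := Fact.mk hp
  have : CharP F p := charP_of_card_eq_prime_pow hF
  have hN : n * p ^ s ≠ 0 := mul_ne_zero hn.ne' (pow_pos hp.pos s).ne'
  have hpow := ambMk_pow_eq p n s (β := β) hα₀
  have hunit : IsUnit (ambMk F (n * p ^ s) (lamAdd F α β) (C (algebraMap F (DualNumber F) β))) :=
    (((isUnit_iff_ne_zero.2 hβ).map (algebraMap F (DualNumber F))).map C).map _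
  have hspan : Ideal.span {ambMk F (n * p ^ s) (lamAdd F α β) (C DualNumber.eps)} =
      Ideal.span {ambMk F (n * p ^ s) (lamAdd F α β)
        ((X ^ n - C α₀ : F[X]).map (algebraMap F (DualNumber F))) ^ p ^ s} := by
    rw [hpow, Ideal.span_singleton_mul_right_unit hunit]
  have hnil : IsNilpotent (ambMk F (n * p ^ s) (lamAdd F α β)
      ((X ^ n - C α₀ : F[X]).map (algebraMap F (DualNumber F)))) := by
    refine ⟨p ^ s * 2, ?_⟩
    rw [pow_mul, hpow, mul_pow, ← map_pow, ← C_pow, pow_two DualNumber.eps,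
      DualNumber.eps_mul_eps, C_0, map_zero, zero_mul]
  have heps : ambMk F (n * p ^ s) (lamAdd F α β)
      ((X ^ n - C α₀ : F[X]).map (algebraMap F (DualNumber F))) ∣
        ambMk F (n * p ^ s) (lamAdd F α β) (C DualNumber.eps) := by
    rw [← hunit.dvd_mul_right, ← hpow]
    exact dvd_pow_self _ (pow_pos hp.pos s).ne'
  refine ⟨hspan, codeOf_span_eps_eq_dualCode hN _, fun I hI =>
    eq_span_eps_of_codeOf_eq_dualCode hN ?_ hI⟩
  rw [hspan]
  exact le_span_pow_or_span_pow_le (isUnit_or_dvd_of_irreducible hirr hnil heps) _ I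
end

section
/- There exist polynomials g_1, …, g_r ∈ F[x] such that in R[x] one has the factorization x^{np^s} − α − uβ = ∏_{j=1}^r (f_j(x)^{p^s} + u g_j(x)), and the factors h_j = f_j^{p^s} + u g_j are pairwise coprime in R[x], i.e., ⟨h_j⟩ + ⟨h_l⟩ = R[x] for all j ≠ l. -/
open Polynomial

/-- First-order expansion of a product along a square-zero element. -/
theorem prod_add_mul_of_mul_self_eq_zero {A ι : Type*} [CommRing A] [DecidableEq ι]
    {e : A} (he : e * e = 0) (t : Finset ι) (a b : ι → A) :
    ∏ i ∈ t, (a i + e * b i) =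
      ∏ i ∈ t, a i + e * ∑ i ∈ t, b i * ∏ j ∈ t.erase i, a j := by
  induction t using Finset.induction_on with
  | empty => simp
  | insert k t hk ih =>
    have hsum : ∑ i ∈ t, b i * ∏ j ∈ (insert k t).erase i, a j =
        a k * ∑ i ∈ t, b i * ∏ j ∈ t.erase i, a j := by
      rw [Finset.mul_sum]
      refine Finset.sum_congr rfl fun i hi => ?_
      have hki : k ≠ i := fun h => hk (h ▸ hi)
      rw [Finset.erase_insert_of_ne hki,
        Finset.prod_insert fun h => hk (Finset.mem_of_mem_erase h)]
      ring
    rw [Finset.prod_insert hk, Finset.prod_insert hk, Finset.sum_insert hk,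
      Finset.erase_insert hk, hsum, ih]
    linear_combination (b k * ∑ i ∈ t, b i * ∏ j ∈ t.erase i, a j) * he

/-- Coprimality is stable under perturbation by multiples of a square-zero element. -/
theorem IsCoprime.add_mul_of_mul_self_eq_zero {A : Type*} [CommRing A] {e a b : A}
    (he : e * e = 0) (h : IsCoprime a b) (c d : A) :
    IsCoprime (a + e * c) (b + e * d) := by
  obtain ⟨x, y, hxy⟩ := h
  refine ⟨(1 - e * (x * c + y * d)) * x, (1 - e * (x * c + y * d)) * y, ?_⟩
  linear_combination (1 - e * (x * c + y * d)) * hxy - (x * c + y * d) ^ 2 * he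

/-- Along a ring homomorphism `φ` and a square-zero element `e`, a factorization into pairwise
coprime factors lifts to any first-order perturbation of the product. -/
theorem exists_prod_add_mul_eq_of_pairwise_isCoprime {B A ι : Type*} [CommRing B] [CommRing A]
    [Fintype ι] [Nonempty ι] (φ : B →+* A) {e : A} (he : e * e = 0) {a : ι → B}
    (ha : Pairwise (Function.onFun IsCoprime a)) (c : B) :
    ∃ g : ι → B, φ (∏ j, a j) + e * φ c = ∏ j, (φ (a j) + e * φ (g j)) ∧
      ∀ j l, j ≠ l → IsCoprime (φ (a j) + e * φ (g j)) (φ (a l) + e * φ (g l)) := by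
  classical
  obtain ⟨μ, hμ⟩ := exists_sum_eq_one_iff_pairwise_coprime'.2 ha
  have hsum : ∑ j, (c * μ j) * ∏ i ∈ Finset.univ.erase j, a i = c := by
    simpa only [Finset.mul_sum, Finset.compl_singleton, mul_one, mul_assoc]
      using congrArg (c * ·) hμ
  refine ⟨fun j => c * μ j, ?_, fun j l hjl =>
    ((ha hjl).map φ).add_mul_of_mul_self_eq_zero he _ _⟩
  rw [prod_add_mul_of_mul_self_eq_zero he]
  nth_rewrite 1 [← hsum]
  simp only [map_sum, map_prod, map_mul]

theorem Polynomial.isCoprime_of_monic_irreducible_ne {K : Type*} [Field K] {f g : K[X]}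
    (hf : f.Monic) (hg : g.Monic) (hfi : Irreducible f) (hgi : Irreducible g) (hne : f ≠ g) :
    IsCoprime f g :=
  hfi.coprime_iff_not_dvd.2 fun h =>
    hne (eq_of_monic_of_associated hf hg (hfi.associated_of_dvd hgi h))

/-- Assume `x^n - α₀` is reducible in `F[x]`, with
`x^n - α₀ = f_1 ⋯ f_r` a product of pairwise distinct monic irreducible polynomials.
Then there exist `g_1, …, g_r ∈ F[x]` such that in `R[x]`
`x^{np^s} - α - uβ = ∏_j (f_j^{p^s} + u g_j)`, and the factors `h_j = f_j^{p^s} + u g_j`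
are pairwise coprime in `R[x]`. -/
theorem stmt_6 (p m n s : ℕ) (hp : p.Prime) (hm : 0 < m) (hn : 0 < n) (hs : 0 < s)
    (hnp : Nat.gcd n p = 1)
    (F : Type) [Field F] [Fintype F] (hF : Fintype.card F = p ^ m)
    (α β α₀ : F) (hα : α ≠ 0) (hβ : β ≠ 0) (hα₀ : α₀ ^ p ^ s = α)
    (hred : ¬ Irreducible ((X : F[X]) ^ n - C α₀))
    (r : ℕ) (f : Fin r → F[X])
    (hmon : ∀ j, (f j).Monic) (hirr : ∀ j, Irreducible (f j))
    (hdist : ∀ j l, j ≠ l → f j ≠ f l)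
    (hfac : ∏ j, f j = (X : F[X]) ^ n - C α₀) :
    ∃ g : Fin r → F[X],
      (X : (DualNumber F)[X]) ^ (n * p ^ s) - C (lamAdd F α β) =
        ∏ j, (((f j).map (algebraMap F (DualNumber F))) ^ p ^ s +
          C DualNumber.eps * (g j).map (algebraMap F (DualNumber F))) ∧
      ∀ j l, j ≠ l →
        IsCoprime
          (((f j).map (algebraMap F (DualNumber F))) ^ p ^ s +
            C DualNumber.eps * (g j).map (algebraMap F (DualNumber F)))
          (((f l).map (algebraMap F (DualNumber F))) ^ p ^ s +
            C DualNumber.eps * (g l).map (algebraMap F (DualNumber F))) := by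
  have : Fact p.Prime := ⟨hp⟩
  have : CharP F p := charP_of_card_eq_prime_pow hF
  have : Nonempty (Fin r) := by
    by_contra hr
    rw [not_nonempty_iff] at hr
    rw [Finset.univ_eq_empty, Finset.prod_empty] at hfac
    have hdeg := congrArg natDegree hfac
    rw [natDegree_one, natDegree_X_pow_sub_C] at hdeg
    omega
  have hcop : Pairwise (Function.onFun IsCoprime fun j => f j ^ p ^ s) := fun j l hjl =>
    (isCoprime_of_monic_irreducible_ne (hmon j) (hmon l) (hirr j) (hirr l) (hdist j l hjl)).pow
  have heps : (C DualNumber.eps : (DualNumber F)[X]) * C DualNumber.eps = 0 := by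
    rw [← C_mul, DualNumber.eps_mul_eps, C_0]
  have hprod : ∏ j, f j ^ p ^ s = X ^ (n * p ^ s) - C α := by
    rw [Finset.prod_pow, hfac, sub_pow_char_pow, ← pow_mul, ← C_pow, hα₀]
  obtain ⟨g, hg, hgcop⟩ := exists_prod_add_mul_eq_of_pairwise_isCoprime
    (A := (DualNumber F)[X]) (mapRingHom (algebraMap F (DualNumber F))) heps hcop (-C β)
  rw [hprod] at hg
  simp only [coe_mapRingHom, Polynomial.map_pow, Polynomial.map_sub, Polynomial.map_neg,
    map_C, map_X] at hg hgcop
  refine ⟨g, Eq.trans ?_ hg, hgcop⟩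
  rw [lamAdd, C_add, C_mul]
  ring
end

section
/- Suppose g_1, …, g_r ∈ F[x] satisfy x^{np^s} − α − uβ = ∏_{j=1}^r (f_j(x)^{p^s} + u g_j(x)) in R[x]. Then for every 1 ≤ j ≤ r, the polynomials f_j and g_j are coprime in F[x] (in particular g_j ≠ 0). -/
open Polynomial

/-- Evaluation of polynomials over the dual numbers of `F` at a point of a commutative `F`-algebra,
with values in the dual numbers of that algebra. -/
noncomputable def dualEval {F K : Type} [Field F] [CommRing K] [Algebra F K] (a : K) :
    (DualNumber F)[X] →+* DualNumber K :=
  eval₂RingHom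
    (DualNumber.lift (R := F) (A := F) (B := DualNumber K)
      ⟨(Algebra.ofId F (DualNumber K), DualNumber.eps),
        DualNumber.eps_mul_eps, fun _ => Commute.all _ _⟩ : DualNumber F →+* DualNumber K)
    (algebraMap K (DualNumber K) a)

section dualEval

variable {F K : Type} [Field F] [CommRing K] [Algebra F K] (a : K)

theorem dualEval_X : dualEval (F := F) a X = algebraMap K (DualNumber K) a := by
  simp [dualEval]

theorem dualEval_C_eps : dualEval (F := F) a (C DualNumber.eps) = DualNumber.eps := by
  simp [dualEval]

theorem dualEval_C_algebraMap (c : F) :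
    dualEval a (C (algebraMap F (DualNumber F) c)) =
      algebraMap K (DualNumber K) (algebraMap F K c) := by
  simp only [dualEval, coe_eval₂RingHom, eval₂_C, RingHom.coe_coe, AlgHom.commutes]
  rfl

theorem dualEval_map (q : F[X]) :
    dualEval a (q.map (algebraMap F (DualNumber F))) = algebraMap K (DualNumber K) (aeval a q) := by
  induction q using Polynomial.induction_on' with
  | add q₁ q₂ h₁ h₂ => simp only [Polynomial.map_add, map_add, h₁, h₂]
  | monomial k c =>
    rw [← C_mul_X_pow_eq_monomial]
    simp only [Polynomial.map_mul, Polynomial.map_pow, map_C, map_X, map_mul, map_pow,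
      dualEval_C_algebraMap, dualEval_X, aeval_C, aeval_X]

end dualEval

/-- Assume `x^n - α₀ = f_1 ⋯ f_r` with `f_j` pairwise distinct monic
irreducible in `F[x]`. If `g_1, …, g_r ∈ F[x]` satisfy
`x^{np^s} - α - uβ = ∏_j (f_j^{p^s} + u g_j)` in `R[x]`, then for every `j` the
polynomials `f_j` and `g_j` are coprime in `F[x]` (in particular `g_j ≠ 0`). -/
theorem stmt_7 (p m n s : ℕ) (hp : p.Prime) (hm : 0 < m) (hn : 0 < n) (hs : 0 < s)
    (hnp : Nat.gcd n p = 1)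
    (F : Type) [Field F] [Fintype F] (hF : Fintype.card F = p ^ m)
    (α β α₀ : F) (hα : α ≠ 0) (hβ : β ≠ 0) (hα₀ : α₀ ^ p ^ s = α)
    (hred : ¬ Irreducible ((X : F[X]) ^ n - C α₀))
    (r : ℕ) (f : Fin r → F[X])
    (hmon : ∀ j, (f j).Monic) (hirr : ∀ j, Irreducible (f j))
    (hdist : ∀ j l, j ≠ l → f j ≠ f l)
    (hfac : ∏ j, f j = (X : F[X]) ^ n - C α₀)
    (g : Fin r → F[X])
    (hprod : (X : (DualNumber F)[X]) ^ (n * p ^ s) - C (lamAdd F α β) =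
      ∏ j, (((f j).map (algebraMap F (DualNumber F))) ^ p ^ s +
        C DualNumber.eps * (g j).map (algebraMap F (DualNumber F)))) :
    ∀ j, IsCoprime (f j) (g j) ∧ g j ≠ 0 := by
  intro j
  have hndvd : ¬ f j ∣ g j := by
    intro hdvd
    have : Fact (Irreducible (f j)) := ⟨hirr j⟩
    let a : AdjoinRoot (f j) := AdjoinRoot.root (f j)
    have hfa : aeval a (f j) = 0 := by
      simp [a, AdjoinRoot.aeval_eq]
    have hga : aeval a (g j) = 0 := by
      simpa [a, AdjoinRoot.aeval_eq] using hdvd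
    have hprod_zero : dualEval (F := F) a (∏ i, (((f i).map (algebraMap F (DualNumber F))) ^ p ^ s +
        C DualNumber.eps * (g i).map (algebraMap F (DualNumber F)))) = 0 := by
      rw [map_prod]
      refine Finset.prod_eq_zero (Finset.mem_univ j) ?_
      rw [map_add, map_mul, map_pow, dualEval_map, dualEval_map, hfa, hga, map_zero, mul_zero,
        zero_pow (pow_ne_zero s hp.ne_zero), add_zero]
    rw [← hprod, lamAdd, C_add, C_mul, map_sub, map_add, map_mul, map_pow, dualEval_X,
      dualEval_C_eps, dualEval_C_algebraMap, dualEval_C_algebraMap, ← map_pow] at hprod_zero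
    have hsnd := congrArg TrivSqZeroExt.snd hprod_zero
    simp [TrivSqZeroExt.algebraMap_eq_inl] at hsnd
    exact hβ hsnd
  refine ⟨(hirr j).coprime_iff_not_dvd.mpr hndvd, ?_⟩
  rintro h0
  exact hndvd (h0 ▸ dvd_zero (f j))
end

section
/- Every nonzero polynomial in F[x] of degree strictly less than d = deg f is invertible in the quotient ring K = R[x]/⟨f(x)^{p^s} + u g(x)⟩. -/
open Polynomial

/-- The ring `K = R[x]/⟨f(x)^{p^s} + u g(x)⟩`, where `R = F + uF = DualNumber F` and
`u = DualNumber.eps` (so `u² = 0`); it is realized as an `AdjoinRoot`, which is by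
definition the quotient ring `R[x] ⧸ ⟨f^{p^s} + u g⟩`. -/
noncomputable abbrev Kring (F : Type) [Field F] (ps : ℕ) (f g : F[X]) : Type :=
  AdjoinRoot ((f.map (algebraMap F (DualNumber F))) ^ ps +
    C DualNumber.eps * g.map (algebraMap F (DualNumber F)))

/-- The natural projection `R[x] → K`. -/
noncomputable abbrev kMk (F : Type) [Field F] (ps : ℕ) (f g : F[X]) :
    (DualNumber F)[X] →+* Kring F ps f g :=
  AdjoinRoot.mk _

/-- The class of `f` is nilpotent in `K`, since `f ^ ps = -u g` and `u² = 0`. -/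
lemma isNilpotent_kMk_map (F : Type) [Field F] (ps : ℕ) (f g : F[X]) :
    IsNilpotent (kMk F ps f g (f.map (algebraMap F (DualNumber F)))) := by
  refine ⟨ps * 2, ?_⟩
  have h : kMk F ps f g (f.map (algebraMap F (DualNumber F))) ^ ps =
      -kMk F ps f g (C DualNumber.eps * g.map (algebraMap F (DualNumber F))) := by
    rw [eq_neg_iff_add_eq_zero, ← map_pow, ← map_add]
    exact AdjoinRoot.mk_self
  have hε : (C DualNumber.eps * g.map (algebraMap F (DualNumber F))) ^ 2 = 0 := by
    refine (mul_pow (C DualNumber.eps) (g.map (algebraMap F (DualNumber F))) 2).trans ?_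
    rw [← C_pow, pow_two, DualNumber.eps_mul_eps, C_0, zero_mul]
  rw [pow_mul, h, neg_sq, ← map_pow, hε, map_zero]

/-- A polynomial over `F` coprime to `f` is invertible in `K`. -/
lemma isUnit_kMk_map_of_isCoprime (F : Type) [Field F] (ps : ℕ) (f g : F[X]) {q : F[X]}
    (h : IsCoprime q f) : IsUnit (kMk F ps f g (q.map (algebraMap F (DualNumber F)))) := by
  obtain ⟨a, b, hab⟩ := h.map
    ((kMk F ps f g).comp (mapRingHom (algebraMap F (DualNumber F))))
  simp only [RingHom.comp_apply, coe_mapRingHom] at hab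
  refine isUnit_of_mul_isUnit_right (x := a) ?_
  rw [eq_sub_of_add_eq hab]
  exact ((Commute.all b _).isNilpotent_mul_left (isNilpotent_kMk_map F ps f g)).isUnit_one_sub

/-- Let `f ∈ F[x]` be monic irreducible of degree `d ≥ 1` and `g ∈ F[x]`
nonzero and coprime to `f`. Then every nonzero polynomial in `F[x]` of degree strictly less
than `d` is invertible in `K = R[x]/⟨f(x)^{p^s} + u g(x)⟩`. -/
theorem stmt_12 (p m s : ℕ) (hp : p.Prime) (hm : 0 < m) (hs : 0 < s)
    (F : Type) [Field F] [Fintype F] (hF : Fintype.card F = p ^ m)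
    (f g : F[X]) (hmon : f.Monic) (hirr : Irreducible f) (hd : 1 ≤ f.natDegree)
    (hg : g ≠ 0) (hcop : IsCoprime f g) :
    ∀ q : F[X], q ≠ 0 → q.degree < (f.natDegree : WithBot ℕ) →
      IsUnit (kMk F (p ^ s) f g (q.map (algebraMap F (DualNumber F)))) := by
  intro q hq hdeg
  refine isUnit_kMk_map_of_isCoprime F _ f g ((hirr.coprime_iff_not_dvd.mpr fun hdvd => ?_).symm)
  rw [← degree_eq_natDegree hirr.ne_zero] at hdeg
  exact hdeg.not_ge (degree_le_of_dvd hdvd hq)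
end

section
/- In the ring K = R[x]/⟨f(x)^{p^s} + u g(x)⟩, the ideal generated by f(x)^{p^s} equals the ideal generated by u, and the element f(x) is nilpotent in K with nilpotency index exactly 2p^s, i.e., f^{2p^s} = 0 in K while f^{2p^s − 1} ≠ 0. -/
open Polynomial

namespace Kring

variable {F : Type} [Field F] {f g : F[X]}

theorem kMk_pow (n : ℕ) :
    kMk F n f g (f.map (algebraMap F (DualNumber F))) ^ n =
      -(kMk F n f g (C DualNumber.eps) *
        kMk F n f g (g.map (algebraMap F (DualNumber F)))) := by
  rw [eq_neg_iff_add_eq_zero, ← map_pow, ← map_mul, ← map_add]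
  exact AdjoinRoot.mk_self

theorem kMk_eps_mul_self (n : ℕ) :
    kMk F n f g (C DualNumber.eps) * kMk F n f g (C DualNumber.eps) = 0 := by
  rw [← map_mul, ← C_mul, DualNumber.eps_mul_eps, C_0, map_zero]

theorem kMk_pow_two_mul (n : ℕ) :
    kMk F n f g (f.map (algebraMap F (DualNumber F))) ^ (2 * n) = 0 := by
  rw [mul_comm, pow_mul, kMk_pow, neg_sq, mul_pow, sq, kMk_eps_mul_self, zero_mul]

theorem span_kMk_pow_eq (n : ℕ) (hcop : IsCoprime f g) :
    Ideal.span {kMk F n f g (f.map (algebraMap F (DualNumber F))) ^ n} =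
      Ideal.span {kMk F n f g (C DualNumber.eps)} := by
  apply le_antisymm <;> rw [Ideal.span_singleton_le_span_singleton]
  · rw [kMk_pow]
    exact (dvd_mul_right _ _).neg_right
  · obtain ⟨a, b, hab⟩ := hcop.pow_left (m := n)
    let ι := (kMk F n f g).comp (mapRingHom (algebraMap F (DualNumber F)))
    have h : ι a * ι f ^ n + ι b * ι g = 1 := by
      rw [← map_pow, ← map_mul, ← map_mul, ← map_add, hab, map_one]
    have hf : ι f ^ n = -(kMk F n f g (C DualNumber.eps) * ι g) := kMk_pow n
    refine ⟨kMk F n f g (C DualNumber.eps) * ι a - ι b, ?_⟩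
    change _ = ι f ^ n * _
    linear_combination -(kMk F n f g (C DualNumber.eps)) * h + ι b * hf

/-- Sending `u` to `-f ^ n / g` gives a ring homomorphism to `F[x] ⧸ (f ^ (2 * n))`
that kills `f ^ n + u g` and fixes `F[x]`. -/
theorem exists_ringHom_killing_modulus (n : ℕ) (hcop : IsCoprime f g) :
    ∃ φ : (DualNumber F)[X] →+* F[X] ⧸ Ideal.span {f ^ (2 * n)},
      (∀ q : F[X], φ (q.map (algebraMap F (DualNumber F))) = Ideal.Quotient.mk _ q) ∧
      φ ((f.map (algebraMap F (DualNumber F))) ^ n +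
        C DualNumber.eps * g.map (algebraMap F (DualNumber F))) = 0 := by
  obtain ⟨a, b, hab⟩ := hcop.pow_left (m := 2 * n)
  let π := Ideal.Quotient.mk (Ideal.span {f ^ (2 * n)})
  have hf : π f ^ (2 * n) = 0 := by
    rw [← map_pow]
    exact Ideal.Quotient.eq_zero_iff_mem.2 (Ideal.mem_span_singleton_self _)
  have hbg : π b * π g = 1 := by
    simpa [hf] using congrArg π hab
  have hsq : -(π b * π f ^ n) * -(π b * π f ^ n) = 0 := by
    linear_combination π b ^ 2 * hf
  let ψ : DualNumber F →ₐ[F] F[X] ⧸ Ideal.span {f ^ (2 * n)} :=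
    DualNumber.lift ⟨(Algebra.ofId F _, -(π b * π f ^ n)), hsq, fun _ => Commute.all _ _⟩
  have hψ : ψ DualNumber.eps = -(π b * π f ^ n) := DualNumber.lift_apply_eps _
  let φ := eval₂RingHom (ψ : DualNumber F →+* F[X] ⧸ Ideal.span {f ^ (2 * n)}) (π X)
  have hφ (q : F[X]) : φ (q.map (algebraMap F (DualNumber F))) = π q := by
    have h : (φ.comp (mapRingHom (algebraMap F (DualNumber F)))) = π := by
      ext c
      · simp [φ]
        rfl
      · simp [φ]
    exact RingHom.congr_fun h q
  have hε : φ (C DualNumber.eps) = -(π b * π f ^ n) := by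
    simpa [φ] using hψ
  refine ⟨φ, hφ, ?_⟩
  rw [map_add, map_pow, map_mul, hφ, hφ, hε]
  linear_combination -(π f ^ n) * hbg

theorem kMk_pow_two_mul_sub_one_ne_zero {n : ℕ} (hn : 0 < n) (hirr : Irreducible f)
    (hcop : IsCoprime f g) :
    kMk F n f g (f.map (algebraMap F (DualNumber F))) ^ (2 * n - 1) ≠ 0 := by
  intro h
  obtain ⟨φ, hφ, hker⟩ := exists_ringHom_killing_modulus n hcop
  rw [← map_pow, AdjoinRoot.mk_eq_zero] at h
  have h0 := map_dvd φ h
  rw [hker, zero_dvd_iff, map_pow, hφ, ← map_pow, Ideal.Quotient.eq_zero_iff_mem,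
    Ideal.mem_span_singleton, pow_dvd_pow_iff hirr.ne_zero hirr.not_isUnit] at h0
  omega

end Kring

/-- Let `f ∈ F[x]` be monic irreducible of degree `d ≥ 1` and `g ∈ F[x]`
nonzero and coprime to `f`. In `K = R[x]/⟨f(x)^{p^s} + u g(x)⟩`, the ideal generated by
`f(x)^{p^s}` equals the ideal generated by `u`, and `f(x)` is nilpotent of nilpotency index
exactly `2p^s`: `f^{2p^s} = 0` in `K` while `f^{2p^s - 1} ≠ 0`. -/
theorem stmt_13 (p m s : ℕ) (hp : p.Prime) (hm : 0 < m) (hs : 0 < s)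
    (F : Type) [Field F] [Fintype F] (hF : Fintype.card F = p ^ m)
    (f g : F[X]) (hmon : f.Monic) (hirr : Irreducible f) (hd : 1 ≤ f.natDegree)
    (hg : g ≠ 0) (hcop : IsCoprime f g) :
    Ideal.span {kMk F (p ^ s) f g (f.map (algebraMap F (DualNumber F))) ^ p ^ s} =
      Ideal.span {kMk F (p ^ s) f g (C DualNumber.eps)} ∧
    kMk F (p ^ s) f g (f.map (algebraMap F (DualNumber F))) ^ (2 * p ^ s) = 0 ∧
    kMk F (p ^ s) f g (f.map (algebraMap F (DualNumber F))) ^ (2 * p ^ s - 1) ≠ 0 := by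
  exact ⟨Kring.span_kMk_pow_eq _ hcop, Kring.kMk_pow_two_mul _,
    Kring.kMk_pow_two_mul_sub_one_ne_zero (pow_pos hp.pos s) hirr hcop⟩
end

section
/- For every integer 0 ≤ i ≤ 2p^s, the ideal ⟨f(x)^i⟩ of K = R[x]/⟨f(x)^{p^s} + u g(x)⟩ has exactly p^{dm(2p^s − i)} elements, where d = deg f. -/
open Polynomial

theorem natCard_span_pow_of_surjective {F S : Type*} [Field F] [Finite F] [CommRing S]
    (φ : F[X] →+* S) (hφ : Function.Surjective φ) {f : F[X]} (hf : f ≠ 0) {n i : ℕ} (hi : i ≤ n)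
    (hker : ∀ a, φ a = 0 ↔ f ^ n ∣ a) :
    Nat.card (Ideal.span {φ f ^ i}) = Nat.card F ^ (f.natDegree * (n - i)) := by
  algebraize [φ]
  let L : F[X] →ₗ[F[X]] S := (Algebra.linearMap F[X] S).comp (LinearMap.mulRight F[X] (f ^ i))
  have hL (a : F[X]) : L a = φ (a * f ^ i) := rfl
  have hLker : LinearMap.ker L = Ideal.span {f ^ (n - i)} := by
    ext a
    rw [LinearMap.mem_ker, hL, hker, Ideal.mem_span_singleton, ← Nat.sub_add_cancel hi, pow_add,
      Nat.add_sub_cancel, mul_dvd_mul_iff_right (pow_ne_zero i hf)]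
  have hLrange (x : S) : x ∈ Ideal.span {φ f ^ i} ↔ x ∈ LinearMap.range L := by
    rw [Ideal.mem_span_singleton', LinearMap.mem_range, hφ.exists]
    simp [hL]
  have : Module.Finite F (F[X] ⧸ Ideal.span {f ^ (n - i)}) :=
    (AdjoinRoot.powerBasis (pow_ne_zero (n - i) hf)).finite
  rw [Nat.card_congr (Equiv.subtypeEquivRight hLrange),
    ← Nat.card_congr L.quotKerEquivRange.toEquiv, hLker, Module.natCard_eq_pow_finrank (K := F),
    finrank_quotient_span_eq_natDegree, natDegree_pow, mul_comm]

namespace Kring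

variable {F : Type} [Field F] {N : ℕ} {f g : F[X]}

variable (F N f g) in
/-- The ring homomorphism `F[x] → K` induced by the inclusion `F ⊆ R`. -/
noncomputable def ofPoly : F[X] →+* Kring F N f g :=
  (kMk F N f g).comp (mapRingHom (algebraMap F (DualNumber F)))

variable (F N f g) in
/-- The image of `u` in `K`. -/
noncomputable def u : Kring F N f g := kMk F N f g (C DualNumber.eps)

theorem u_mul_u : u F N f g * u F N f g = 0 := by
  rw [u, ← map_mul, ← C_mul, DualNumber.eps_mul_eps, C_0, map_zero]

theorem ofPoly_pow_add_u_mul : ofPoly F N f g f ^ N + u F N f g * ofPoly F N f g g = 0 := by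
  simp only [ofPoly, u, RingHom.comp_apply, ← map_pow, ← map_mul, ← map_add]
  simp

theorem ofPoly_pow_two_mul : ofPoly F N f g (f ^ (2 * N)) = 0 := by
  rw [map_pow, mul_comm, pow_mul, eq_neg_of_add_eq_zero_left ofPoly_pow_add_u_mul]
  linear_combination (ofPoly F N f g g) ^ 2 * u_mul_u (F := F) (N := N) (f := f) (g := g)

theorem ofPoly_surjective (hcop : IsCoprime f g) : Function.Surjective (ofPoly F N f g) := by
  obtain ⟨a, h, hah⟩ := hcop.pow_left (m := 2 * N)
  have hu : u F N f g = ofPoly F N f g (-(h * f ^ N)) := by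
    have h1 := congrArg (ofPoly F N f g) hah
    simp only [map_add, map_mul, ofPoly_pow_two_mul, map_one] at h1
    simp only [map_neg, map_mul, map_pow]
    linear_combination -u F N f g * h1 +
      ofPoly F N f g h * ofPoly_pow_add_u_mul (F := F) (N := N) (f := f) (g := g)
  have hC (r : DualNumber F) : kMk F N f g (C r) ∈ (ofPoly F N f g).range := by
    have hr : r = algebraMap F (DualNumber F) r.fst +
        algebraMap F (DualNumber F) r.snd * DualNumber.eps := by
      ext <;> simp [TrivSqZeroExt.algebraMap_eq_inl]
    rw [hr, C_add, C_mul, map_add, map_mul]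
    have hF (c : F) : kMk F N f g (C (algebraMap F (DualNumber F) c)) ∈ (ofPoly F N f g).range :=
      ⟨C c, by simp [ofPoly]⟩
    exact add_mem (hF _) (mul_mem (hF _) ⟨_, hu.symm⟩)
  have hX : kMk F N f g X ∈ (ofPoly F N f g).range := ⟨X, by simp [ofPoly]⟩
  intro y
  obtain ⟨q, rfl⟩ := AdjoinRoot.mk_surjective y
  change kMk F N f g q ∈ (ofPoly F N f g).range
  rw [q.as_sum_range_C_mul_X_pow, map_sum]
  refine sum_mem fun k _ => ?_
  rw [map_mul, map_pow]
  exact mul_mem (hC _) (pow_mem hX k)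

theorem ofPoly_eq_zero_iff (hcop : IsCoprime f g) (a : F[X]) :
    ofPoly F N f g a = 0 ↔ f ^ (2 * N) ∣ a := by
  refine ⟨fun ha => ?_, fun ⟨b, hb⟩ => by rw [hb, map_mul, ofPoly_pow_two_mul, zero_mul]⟩
  obtain ⟨c, h, hch⟩ := hcop.pow_left (m := 2 * N)
  let π : F[X] →ₐ[F] AdjoinRoot (f ^ (2 * N)) := AdjoinRoot.mkₐ _
  have hπ (b : F[X]) : π b = 0 ↔ f ^ (2 * N) ∣ b := AdjoinRoot.mk_eq_zero
  have hf : π f ^ (2 * N) = 0 := by rw [← map_pow, hπ]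
  have hhg : π h * π g = 1 := by simpa [hf] using congrArg π hch
  let ψ : DualNumber F →ₐ[F] AdjoinRoot (f ^ (2 * N)) :=
    DualNumber.lift ⟨(Algebra.ofId F _, -(π h * π f ^ N)),
      by linear_combination π h ^ 2 * hf, fun _ => Commute.all _ _⟩
  have hψ (b : F[X]) :
      (b.map (algebraMap F (DualNumber F))).eval₂ ψ.toRingHom (π X) = π b := by
    rw [eval₂_map, ψ.toRingHom_eq_coe, ψ.comp_algebraMap, ← aeval_def, aeval_algHom_apply,
      aeval_X_left_apply]
  have hψε : ψ DualNumber.eps = -(π h * π f ^ N) := DualNumber.lift_apply_eps _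
  let Ψ : Kring F N f g →+* AdjoinRoot (f ^ (2 * N)) :=
    AdjoinRoot.lift ψ.toRingHom (π X) (by
      rw [eval₂_add, eval₂_mul, eval₂_pow, eval₂_C, hψ, hψ]
      change _ + ψ DualNumber.eps * _ = 0
      rw [hψε]
      linear_combination -π f ^ N * hhg)
  rw [← hπ, ← hψ, ← map_zero Ψ, ← ha]
  exact (AdjoinRoot.lift_mk _ _).symm

end Kring

/-- Let `f ∈ F[x]` be monic irreducible of degree `d ≥ 1` and `g ∈ F[x]`
nonzero and coprime to `f`. For every `0 ≤ i ≤ 2p^s`, the ideal `⟨f(x)^i⟩` of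
`K = R[x]/⟨f(x)^{p^s} + u g(x)⟩` has exactly `p^{dm(2p^s − i)}` elements. -/
theorem stmt_15 (p m s : ℕ) (hp : p.Prime) (hm : 0 < m) (hs : 0 < s)
    (F : Type) [Field F] [Fintype F] (hF : Fintype.card F = p ^ m)
    (f g : F[X]) (hmon : f.Monic) (hirr : Irreducible f) (hd : 1 ≤ f.natDegree)
    (hg : g ≠ 0) (hcop : IsCoprime f g) :
    ∀ i ≤ 2 * p ^ s,
      Nat.card (Ideal.span {kMk F (p ^ s) f g (f.map (algebraMap F (DualNumber F))) ^ i}) =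
        p ^ (f.natDegree * m * (2 * p ^ s - i)) := by
  intro i hi
  have h := natCard_span_pow_of_surjective (Kring.ofPoly F (p ^ s) f g)
    (Kring.ofPoly_surjective hcop) hmon.ne_zero hi (Kring.ofPoly_eq_zero_iff hcop)
  rw [Nat.card_eq_fintype_card (α := F), hF, ← pow_mul] at h
  rw [mul_comm f.natDegree m, mul_assoc]
  exact h
end

section
/- Every (α + uβ)-constacyclic code C of length np^s over R, i.e., every ideal C of 𝓡 = R[x]/⟨x^{np^s} − (α + uβ)⟩, has the form C = ⊕_{j=1}^r ε_j·⟨f_j(x)^{i_j}⟩ (mod x^{np^s} − α − uβ) for integers 0 ≤ i_j ≤ 2p^s (where ⟨f_j^{i_j}⟩ denotes the ideal of K_j generated by f_j^{i_j} and ε_j·⟨f_j^{i_j}⟩ its image in 𝓡 under a ↦ ε_j a), and the number of codewords of C equals p^{Σ_{j=1}^r d_j m (2p^s − i_j)}, where d_j = deg f_j. -/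
open Polynomial

/-- A divisor of a product of prime powers is, up to a unit, a product of smaller powers. -/
theorem exists_associated_prod_pow_of_dvd_prod_pow {M ι : Type*} [CommMonoidWithZero M]
    [IsCancelMulZero M] [DecompositionMonoid M] (t : Finset ι) (q : ι → M)
    (hq : ∀ j, Prime (q j)) (k : ℕ) (d : M) (hd : d ∣ ∏ j ∈ t, q j ^ k) :
    ∃ i : ι → ℕ, (∀ j, i j ≤ k) ∧ Associated d (∏ j ∈ t, q j ^ i j) := by
  classical
  induction t using Finset.induction_on generalizing d with
  | empty =>
    refine ⟨fun _ => 0, fun _ => Nat.zero_le _, ?_⟩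
    simpa [associated_one_iff_isUnit, isUnit_iff_dvd_one] using hd
  | insert a t ha ih =>
    rw [Finset.prod_insert ha] at hd
    obtain ⟨b, c, hb, hc, rfl⟩ := exists_dvd_and_dvd_of_dvd_mul hd
    obtain ⟨e, he, hbe⟩ := (dvd_prime_pow (hq a) k).1 hb
    obtain ⟨i, hi, hci⟩ := ih c hc
    refine ⟨Function.update i a e, fun j => ?_, ?_⟩
    · rcases eq_or_ne j a with rfl | hj
      · simpa using he
      · simpa [hj] using hi j
    · rw [Finset.prod_insert ha, Function.update_self]
      refine hbe.mul_mul ?_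
      rwa [Finset.prod_congr rfl fun j hj => ?_]
      rw [Function.update_of_ne (ne_of_mem_of_not_mem hj ha)]

theorem natCard_polynomial_quotient_span {F : Type*} [Field F] [Finite F] {d : F[X]}
    (hd : d ≠ 0) : Nat.card (F[X] ⧸ Ideal.span {d}) = Nat.card F ^ d.natDegree := by
  have : Module.Finite F (F[X] ⧸ Ideal.span {d}) := (AdjoinRoot.powerBasis hd).finite
  rw [Module.natCard_eq_pow_finrank (K := F), finrank_quotient_span_eq_natDegree]

theorem natCard_adjoinRoot_of_monic {R : Type*} [CommRing R] [Finite R] {g : R[X]}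
    (hg : g.Monic) : Nat.card (AdjoinRoot g) = Nat.card R ^ g.natDegree := by
  rw [Nat.card_congr (AdjoinRoot.powerBasis' hg).basis.equivFun.toEquiv, Nat.card_fun,
    Nat.card_fin, AdjoinRoot.powerBasis'_dim]

theorem natCard_dualNumber (F : Type*) : Nat.card (DualNumber F) = Nat.card F ^ 2 :=
  (Nat.card_prod F F).trans (sq _).symm

/-- The elements `∑ j, s j * ∏ l ≠ j, h l` built from Bézout relations for pairwise coprime `h`
add up to `1` modulo `∏ j, h j`. -/
theorem prod_dvd_one_sub_sum_of_bezout {R ι : Type*} [CommRing R] [Fintype ι] [DecidableEq ι]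
    {h s t : ι → R} (hcop : ∀ j l, j ≠ l → IsCoprime (h j) (h l))
    (hst : ∀ j, s j * ∏ l ∈ Finset.univ.erase j, h l + t j * h j = 1) :
    ∏ j, h j ∣ 1 - ∑ j, s j * ∏ l ∈ Finset.univ.erase j, h l := by
  refine Finset.prod_dvd_of_coprime (fun j _ l _ hjl => hcop j l hjl) fun j _ => ?_
  rw [← Finset.add_sum_erase _ _ (Finset.mem_univ j), ← sub_sub, ← hst j, add_sub_cancel_left]
  refine dvd_sub (dvd_mul_left _ _) (Finset.dvd_sum fun l hl => Dvd.dvd.mul_left ?_ _)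
  exact Finset.dvd_prod_of_mem h (Finset.mem_erase.2 ⟨(Finset.ne_of_mem_erase hl).symm,
    Finset.mem_univ j⟩)

/-- The size of an ideal `I` of a surjective image of `F[X]`, from a generator of its preimage. -/
theorem natCard_ideal_mul_pow_natDegree {F A : Type*} [Field F] [Finite F] [CommRing A]
    {φ : F[X] →+* A} (hφ : Function.Surjective φ) (I : Ideal A) {d : F[X]} (hd : d ≠ 0)
    (hI : I.comap φ = Ideal.span {d}) :
    Nat.card I * Nat.card F ^ d.natDegree = Nat.card A := by
  let ψ : F[X] →+* A ⧸ I := (Ideal.Quotient.mk I).comp φ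
  have hψ : Function.Surjective ψ := Ideal.Quotient.mk_surjective.comp hφ
  have hker : RingHom.ker ψ = Ideal.span {d} := by
    rw [← hI, ← RingHom.comap_ker, Ideal.mk_ker]
  rw [← natCard_polynomial_quotient_span hd, ← hker,
    Nat.card_congr (RingHom.quotientKerEquivOfSurjective hψ).toEquiv]
  exact (Submodule.card_eq_card_quotient_mul_card I).symm

/-- If the `ε j` sum to `1` and `ε j` is divisible by a high power of each `q l` with `l ≠ j`, then `∏ j, q j ^ i j` generates the sum of the ideals `(ε j * q j ^ i j)`. -/
theorem span_prod_pow_eq_sum_span {A ι : Type*} [CommRing A] [Fintype ι] [DecidableEq ι]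
    {ε q : ι → A} {k : ℕ} (hsum : ∑ j, ε j = 1)
    (hε : ∀ j, ∏ l ∈ Finset.univ.erase j, q l ^ k ∣ ε j)
    {i : ι → ℕ} (hi : ∀ j, i j ≤ k) :
    Ideal.span {∏ j, q j ^ i j} = ∑ j, Ideal.span {ε j * q j ^ i j} := by
  rw [Ideal.sum_eq_sup, Finset.sup_univ_eq_iSup]
  apply le_antisymm
  · rw [Ideal.span_singleton_le_iff_mem, ← one_mul (∏ j, q j ^ i j), ← hsum, Finset.sum_mul]
    refine Ideal.sum_mem _ fun j _ => Ideal.mem_iSup_of_mem j ?_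
    exact Ideal.mem_span_singleton.2
      (mul_dvd_mul_left _ (Finset.dvd_prod_of_mem (fun j => q j ^ i j) (Finset.mem_univ j)))
  · refine iSup_le fun j => Ideal.span_singleton_le_span_singleton.2 ?_
    rw [← Finset.mul_prod_erase _ _ (Finset.mem_univ j), mul_comm]
    exact mul_dvd_mul_right ((Finset.prod_dvd_prod_of_dvd _ _
      fun l _ => pow_dvd_pow (q l) (hi l)).trans (hε j)) _

/-- Assume `x^n - α₀ = f_1 ⋯ f_r` with `f_j` pairwise distinct monic
irreducible in `F[x]`, and `x^{np^s} - α - uβ = ∏_j h_j` in `R[x]` with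
`h_j = f_j^{p^s} + u g_j` pairwise coprime; let `ε_j` be the associated idempotents of
`𝓡 = R[x]/⟨x^{np^s} - (α + uβ)⟩`. Then every ideal `C` of `𝓡` (i.e. every
`(α + uβ)`-constacyclic code of length `np^s` over `R`) has the form
`C = ⊕_j ε_j·⟨f_j^{i_j}⟩` for some `0 ≤ i_j ≤ 2p^s`, and the number of codewords of `C`
is `p^{Σ_j d_j m (2p^s − i_j)}` where `d_j = deg f_j`. -/
theorem stmt_16 (p m n s : ℕ) (hp : p.Prime) (hm : 0 < m) (hn : 0 < n) (hs : 0 < s)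
    (hnp : Nat.gcd n p = 1)
    (F : Type) [Field F] [Fintype F] (hF : Fintype.card F = p ^ m)
    (α β α₀ : F) (hα : α ≠ 0) (hβ : β ≠ 0) (hα₀ : α₀ ^ p ^ s = α)
    (hred : ¬ Irreducible ((X : F[X]) ^ n - C α₀))
    (r : ℕ) (f : Fin r → F[X])
    (hmon : ∀ j, (f j).Monic) (hirrf : ∀ j, Irreducible (f j))
    (hdist : ∀ j l, j ≠ l → f j ≠ f l)
    (hffac : ∏ j, f j = (X : F[X]) ^ n - C α₀)
    (g : Fin r → F[X]) (h : Fin r → (DualNumber F)[X])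
    (hh : ∀ j, h j = ((f j).map (algebraMap F (DualNumber F))) ^ p ^ s +
      C DualNumber.eps * (g j).map (algebraMap F (DualNumber F)))
    (hcop : ∀ j l, j ≠ l → IsCoprime (h j) (h l))
    (hfac : ∏ j, h j = (X : (DualNumber F)[X]) ^ (n * p ^ s) - C (lamAdd F α β))
    (sf tf : Fin r → (DualNumber F)[X])
    (hst : ∀ j, sf j * ∏ l ∈ Finset.univ.erase j, h l + tf j * h j = 1)
    (ε : Fin r → Amb F (n * p ^ s) (lamAdd F α β))
    (hε : ∀ j, ε j = ambMk F (n * p ^ s) (lamAdd F α β)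
      (sf j * ∏ l ∈ Finset.univ.erase j, h l)) :
    ∀ I : Ideal (Amb F (n * p ^ s) (lamAdd F α β)),
      ∃ i : Fin r → ℕ, (∀ j, i j ≤ 2 * p ^ s) ∧
        I = (∑ j, Ideal.span {ε j * ambMk F (n * p ^ s) (lamAdd F α β)
          (((f j).map (algebraMap F (DualNumber F))) ^ i j)}) ∧
        Nat.card I = p ^ (∑ j, (f j).natDegree * m * (2 * p ^ s - i j)) := by
  classical
  intro I
  have := Fact.mk hp
  have : CharP F p := charP_of_card_eq_prime_pow hF
  have hnc : Nat.card F = p ^ m := by rw [Nat.card_eq_fintype_card, hF]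
  let φ : F[X] →+* Amb F (n * p ^ s) (lamAdd F α β) :=
    (ambMk F (n * p ^ s) (lamAdd F α β)).comp (mapRingHom (algebraMap F (DualNumber F)))
  let u : Amb F (n * p ^ s) (lamAdd F α β) :=
    ambMk F (n * p ^ s) (lamAdd F α β) (C DualNumber.eps)
  have hφ_apply (a : F[X]) : ambMk F (n * p ^ s) (lamAdd F α β)
      (a.map (algebraMap F (DualNumber F))) = φ a := rfl
  have hprod_zero : ambMk F (n * p ^ s) (lamAdd F α β) (∏ j, h j) = 0 := by
    rw [hfac]; exact AdjoinRoot.mk_self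
  have hfpow : (∏ j, f j) ^ p ^ s = (X : F[X]) ^ (n * p ^ s) - C α := by
    rw [hffac, sub_pow_char_pow, ← pow_mul, ← C_pow, hα₀]
  have hu : φ ((∏ j, f j) ^ p ^ s) = u * φ (C β) := by
    have h0 : ambMk F (n * p ^ s) (lamAdd F α β)
        (X ^ (n * p ^ s) - C (lamAdd F α β)) = 0 := AdjoinRoot.mk_self
    rw [hfpow, ← hφ_apply, ← hφ_apply, ← map_mul, ← sub_eq_zero, ← map_sub, ← h0]
    congr 1
    simp only [Polynomial.map_sub, Polynomial.map_pow, map_X, map_C, lamAdd, C_add, C_mul]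
    ring
  have hββ : φ (C β) * φ (C β⁻¹) = 1 := by
    rw [← map_mul, ← C_mul, mul_inv_cancel₀ hβ, C_1, map_one]
  have hu' : u = φ (C β⁻¹ * (∏ j, f j) ^ p ^ s) := by
    rw [map_mul, hu]
    linear_combination (-u) * hββ
  have huu : u * u = 0 := by
    rw [← map_mul, ← C_mul, DualNumber.eps_mul_eps, C_0, map_zero]
  have hsurj : Function.Surjective φ := by
    intro a
    obtain ⟨b, rfl⟩ := AdjoinRoot.mk_surjective a
    change b ∈ φ.range.comap (ambMk F (n * p ^ s) (lamAdd F α β))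
    induction b using Polynomial.induction_on' with
    | add b c hb hc => exact add_mem hb hc
    | monomial k c =>
      rw [← C_mul_X_pow_eq_monomial]
      refine mul_mem ?_ (pow_mem (Subring.mem_comap.2 (RingHom.mem_range.2 ⟨X, ?_⟩)) k)
      · rw [← TrivSqZeroExt.inl_fst_add_inr_snd_eq c, C_add,
          DualNumber.inr_eq_smul_eps]
        refine add_mem (Subring.mem_comap.2 (RingHom.mem_range.2 ⟨C (TrivSqZeroExt.fst c), ?_⟩))
          (Subring.mem_comap.2 (RingHom.mem_range.2
            ⟨C (TrivSqZeroExt.snd c) * (C β⁻¹ * (∏ j, f j) ^ p ^ s), ?_⟩))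
        · rw [← hφ_apply, map_C]; rfl
        · rw [map_mul, ← hu', ← hφ_apply, ← map_mul, map_C, ← C_mul, Algebra.smul_def]
      · rw [← hφ_apply, map_X]
  have hzero : φ (∏ j, f j ^ (2 * p ^ s)) = 0 := by
    rw [Finset.prod_pow, two_mul, pow_add, ← sq, map_pow, hu, mul_pow, sq u, huu, zero_mul]
  obtain ⟨d, hd⟩ : ∃ d, I.comap φ = Ideal.span {d} :=
    ((I.comap φ).isPrincipal_iff).1 inferInstance
  have hddvd : d ∣ ∏ j, f j ^ (2 * p ^ s) := by
    rw [← Ideal.mem_span_singleton, ← hd, Ideal.mem_comap, hzero]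
    exact I.zero_mem
  obtain ⟨i, hi, hdi⟩ := exists_associated_prod_pow_of_dvd_prod_pow Finset.univ f
    (fun j => (hirrf j).prime) _ d hddvd
  rw [Ideal.span_singleton_eq_span_singleton.2 hdi] at hd
  refine ⟨i, hi, ?_, ?_⟩
  · have hsum : ∑ j, ε j = 1 := by
      have := map_dvd (ambMk F (n * p ^ s) (lamAdd F α β))
        (prod_dvd_one_sub_sum_of_bezout hcop hst)
      rw [hprod_zero, zero_dvd_iff, map_sub, map_one, map_sum, sub_eq_zero] at this
      simp only [hε, this]
    have hidem (j) : ε j * ε j = ε j := by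
      have h1 : ε j + ambMk F (n * p ^ s) (lamAdd F α β) (tf j * h j) = 1 := by
        rw [hε, ← map_add, hst, map_one]
      have h2 : ε j * ambMk F (n * p ^ s) (lamAdd F α β) (tf j * h j) = 0 := by
        have h3 : (sf j * ∏ l ∈ Finset.univ.erase j, h l) * (tf j * h j) =
            sf j * tf j * ∏ l, h l := by
          rw [← Finset.mul_prod_erase _ _ (Finset.mem_univ j)]
          ring
        rw [hε, ← map_mul, h3, map_mul, hprod_zero, mul_zero]
      linear_combination ε j * h1 - h2
    have hfh (l) : φ (f l) ^ p ^ s ∣ ambMk F (n * p ^ s) (lamAdd F α β) (h l) := by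
      rw [hh, map_add, map_mul, map_pow, hφ_apply]
      refine dvd_add dvd_rfl (Dvd.dvd.mul_right ?_ _)
      change _ ∣ u
      rw [hu', ← map_pow]
      exact map_dvd φ (Dvd.dvd.mul_left (pow_dvd_pow_of_dvd
        (Finset.dvd_prod_of_mem f (Finset.mem_univ l)) _) _)
    have hdvd (j) : ∏ l ∈ Finset.univ.erase j, φ (f l) ^ (2 * p ^ s) ∣ ε j := by
      have h1 : ∏ l ∈ Finset.univ.erase j, φ (f l) ^ p ^ s ∣ ε j := by
        rw [hε, map_mul, map_prod]
        exact Dvd.dvd.mul_left (Finset.prod_dvd_prod_of_dvd _ _ fun l _ => hfh l) _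
      rw [← hidem j]
      simpa only [two_mul, pow_add, Finset.prod_mul_distrib] using mul_dvd_mul h1 h1
    simp only [map_pow, hφ_apply]
    rw [← span_prod_pow_eq_sum_span hsum hdvd hi, ← Ideal.map_comap_of_surjective φ hsurj I,
      hd, Ideal.map_span, Set.image_singleton, map_prod]
    simp only [map_pow]
  · have hdeg : (∏ j, f j ^ i j).natDegree = ∑ j, i j * (f j).natDegree := by
      rw [natDegree_prod_of_monic _ _ fun j _ => (hmon j).pow _]
      simp only [natDegree_pow]
    have hn_sum : ∑ j, (f j).natDegree = n := by
      rw [← natDegree_prod_of_monic _ _ fun j _ => hmon j, hffac, natDegree_X_pow_sub_C]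
    have hne : ∏ j, f j ^ i j ≠ 0 :=
      (monic_prod_of_monic _ _ fun j _ => (hmon j).pow _).ne_zero
    have hN : n * p ^ s ≠ 0 := mul_ne_zero hn.ne' (pow_ne_zero _ hp.ne_zero)
    have hcard := natCard_ideal_mul_pow_natDegree hsurj I hne hd
    have : Finite (DualNumber F) := inferInstanceAs (Finite (F × F))
    rw [natCard_adjoinRoot_of_monic (monic_X_pow_sub_C _ hN), natDegree_X_pow_sub_C,
      natCard_dualNumber, hnc, hdeg] at hcard
    refine Nat.eq_of_mul_eq_mul_right
      (pow_pos (pow_pos hp.pos m) (∑ j, i j * (f j).natDegree)) (hcard.trans ?_)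
    rw [← pow_mul, ← pow_mul, ← pow_mul, ← pow_add]
    congr 1
    rw [← hn_sum, Finset.sum_mul, Finset.mul_sum, Finset.mul_sum, Finset.mul_sum,
      ← Finset.sum_add_distrib]
    refine Finset.sum_congr rfl fun j _ => ?_
    obtain ⟨c, hc⟩ := Nat.exists_eq_add_of_le (hi j)
    rw [hc, Nat.add_sub_cancel_left]
    linear_combination m * (f j).natDegree * hc
end

section
/- The number of (α + uβ)-constacyclic codes of length np^s over R, i.e., the number of ideals of the ring 𝓡 = R[x]/⟨x^{np^s} − (α + uβ)⟩, is exactly (2p^s + 1)^r, where r is the number of distinct monic irreducible factors of x^n − α₀ in F[x]. -/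
open Polynomial

/-- A divisor of a product of prime powers is associated to a product of smaller powers. -/
theorem exists_associated_prod_pow_of_dvd {R ι : Type*} [CommMonoidWithZero R]
    [IsCancelMulZero R] [DecompositionMonoid R] (f : ι → R) (hf : ∀ i, Prime (f i)) (M : ℕ)
    (t : Finset ι) {d : R} (hd : d ∣ ∏ i ∈ t, f i ^ M) :
    ∃ e : ι → ℕ, (∀ i, e i ≤ M) ∧ Associated d (∏ i ∈ t, f i ^ e i) := by
  classical
  induction t using Finset.induction_on generalizing d with
  | empty =>
    refine ⟨fun _ => 0, fun _ => Nat.zero_le _, ?_⟩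
    simpa [associated_one_iff_isUnit, isUnit_iff_dvd_one] using hd
  | insert a t ha ih =>
    rw [Finset.prod_insert ha] at hd
    obtain ⟨b, c, hb, hc, rfl⟩ := exists_dvd_and_dvd_of_dvd_mul hd
    obtain ⟨k, hk, hbk⟩ := (dvd_prime_pow (hf a) M).1 hb
    obtain ⟨e, he, hce⟩ := ih hc
    refine ⟨Function.update e a k, fun i => ?_, ?_⟩
    · by_cases h : i = a
      · subst h; simpa using hk
      · simpa [h] using he i
    · rw [Finset.prod_insert ha, Function.update_self,
        Finset.prod_congr rfl fun i hi => by
          rw [Function.update_of_ne (ne_of_mem_of_not_mem hi ha)]]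
      exact hbk.mul_mul hce

/-- Exponents of a product of pairwise non-associated primes grow along divisibility. -/
theorem exponent_le_of_prod_pow_dvd {R ι : Type*} [CommMonoidWithZero R] [IsCancelMulZero R]
    [Fintype ι] (f : ι → R) (hf : ∀ i, Prime (f i))
    (hdist : Pairwise fun i j => ¬ Associated (f i) (f j)) {e e' : ι → ℕ}
    (h : ∏ i, f i ^ e i ∣ ∏ i, f i ^ e' i) (i : ι) : e i ≤ e' i := by
  classical
  have h₁ : f i ^ e i ∣ f i ^ e' i * ∏ j ∈ Finset.univ.erase i, f j ^ e' j := by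
    rw [Finset.mul_prod_erase _ (fun j => f j ^ e' j) (Finset.mem_univ i)]
    exact (Finset.dvd_prod_of_mem (fun j => f j ^ e j) (Finset.mem_univ i)).trans h
  have h₂ : ¬ f i ∣ ∏ j ∈ Finset.univ.erase i, f j ^ e' j := by
    intro hdvd
    obtain ⟨j, hj, hij⟩ := ((hf i).dvd_finsetProd_iff _).1 hdvd
    exact hdist (Finset.ne_of_mem_erase hj).symm
      ((hf i).associated_of_dvd (hf j) ((hf i).dvd_of_dvd_pow hij))
  exact (pow_dvd_pow_iff (hf i).ne_zero (hf i).not_isUnit).1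
    ((hf i).pow_dvd_of_dvd_mul_right _ h₂ h₁)

/-- The number of ideals of a quotient of a principal ideal domain by a product of `M`-th powers
of pairwise non-associated primes. -/
theorem card_ideal_of_ker_eq_span_prod_pow {R S ι : Type*} [CommRing R] [IsDomain R]
    [IsPrincipalIdealRing R] [CommRing S] [Fintype ι] (f : ι → R) (hf : ∀ i, Prime (f i))
    (hdist : Pairwise fun i j => ¬ Associated (f i) (f j)) (M : ℕ) (φ : R →+* S)
    (hφ : Function.Surjective φ) (hker : RingHom.ker φ = Ideal.span {∏ i, f i ^ M}) :
    Nat.card (Ideal S) = (M + 1) ^ Fintype.card ι := by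
  classical
  let I (e : ι → Fin (M + 1)) : Ideal R := Ideal.span {∏ i, f i ^ (e i : ℕ)}
  have hI (e) : (Ideal.map φ (I e)).comap φ = I e := by
    rw [Ideal.comap_map_of_surjective φ hφ, sup_eq_left]
    change RingHom.ker φ ≤ I e
    rw [hker, Ideal.span_singleton_le_span_singleton]
    exact Finset.prod_dvd_prod_of_dvd _ _ fun i _ => pow_dvd_pow _ (Nat.lt_succ_iff.1 (e i).2)
  have hle {e e'} (h : I e' ≤ I e) (i : ι) : (e i : ℕ) ≤ e' i :=
    exponent_le_of_prod_pow_dvd f hf hdist (e := fun i => (e i : ℕ)) (e' := fun i => (e' i : ℕ))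
      (Ideal.span_singleton_le_span_singleton.1 h) i
  have hbij : Function.Bijective fun e => Ideal.map φ (I e) := by
    constructor
    · intro e e' h
      have h' : I e = I e' := by rw [← hI e, ← hI e']; exact congrArg _ h
      exact funext fun i => Fin.ext (le_antisymm (hle h'.ge i) (hle h'.le i))
    · intro J
      obtain ⟨d, hd⟩ := IsPrincipalIdealRing.principal (J.comap φ)
      rw [← Ideal.span] at hd
      have hdvd : d ∣ ∏ i, f i ^ M := by
        rw [← Ideal.span_singleton_le_span_singleton, ← hker, ← hd]
        exact Ideal.comap_mono bot_le
      obtain ⟨e, he, hde⟩ := exists_associated_prod_pow_of_dvd f hf M Finset.univ hdvd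
      refine ⟨fun i => ⟨e i, Nat.lt_succ_iff.2 (he i)⟩, ?_⟩
      change Ideal.map φ (Ideal.span {∏ i, f i ^ e i}) = J
      rw [← Ideal.span_singleton_eq_span_singleton.2 hde]
      exact (congrArg _ hd).symm.trans (Ideal.map_comap_of_surjective φ hφ J)
  rw [← Nat.card_congr (Equiv.ofBijective _ hbij)]
  simp

section Constacyclic

variable (F : Type) [Field F] (N : ℕ)

/-- The evaluation map from `F[x]` to the ambient ring. -/
noncomputable def polyToAmb (l : DualNumber F) : F[X] →+* Amb F N l :=
  (ambMk F N l).comp (mapRingHom (algebraMap F (DualNumber F)))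

theorem polyToAmb_X_pow_sub_C (α β : F) :
    polyToAmb F N (lamAdd F α β) (X ^ N - C α) =
      ambMk F N (lamAdd F α β) (C (DualNumber.eps * algebraMap F (DualNumber F) β)) := by
  rw [polyToAmb, RingHom.comp_apply, AdjoinRoot.mk_eq_mk]
  refine dvd_of_eq ?_
  simp [lamAdd, sub_sub]

theorem polyToAmb_X_pow_sub_C_sq (α β : F) :
    polyToAmb F N (lamAdd F α β) ((X ^ N - C α) ^ 2) = 0 := by
  rw [map_pow, polyToAmb_X_pow_sub_C, ← map_pow, ← map_pow, mul_pow, pow_two DualNumber.eps,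
    DualNumber.eps_mul_eps]
  simp

theorem polyToAmb_surjective {α β : F} (hβ : β ≠ 0) :
    Function.Surjective (polyToAmb F N (lamAdd F α β)) := by
  have hC (a : F) : polyToAmb F N (lamAdd F α β) (C a) =
      ambMk F N (lamAdd F α β) (C (algebraMap F (DualNumber F) a)) := by
    simp [polyToAmb]
  have heps : polyToAmb F N (lamAdd F α β) (C β⁻¹ * (X ^ N - C α)) =
      ambMk F N (lamAdd F α β) (C DualNumber.eps) := by
    rw [map_mul, polyToAmb_X_pow_sub_C, hC, ← map_mul, ← C_mul, mul_left_comm, ← map_mul,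
      inv_mul_cancel₀ hβ, map_one, mul_one]
  intro y
  induction y using AdjoinRoot.induction_on with
  | ih q =>
    induction q using Polynomial.induction_on' with
    | add a b ha hb =>
      obtain ⟨a', ha'⟩ := ha
      obtain ⟨b', hb'⟩ := hb
      exact ⟨a' + b', by rw [map_add, map_add, ha', hb']⟩
    | monomial k c =>
      refine ⟨(C c.fst + C c.snd * (C β⁻¹ * (X ^ N - C α))) * X ^ k, ?_⟩
      have hX : polyToAmb F N (lamAdd F α β) X = ambMk F N (lamAdd F α β) X := by
        simp [polyToAmb]
      have hc : c = algebraMap F (DualNumber F) c.fst +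
          algebraMap F (DualNumber F) c.snd * DualNumber.eps := by
        ext <;> simp [TrivSqZeroExt.algebraMap_eq_inl]
      rw [map_mul, map_add, map_mul, heps, hC, hC, map_pow, hX, ← map_mul, ← map_add, ← map_pow,
        ← map_mul, ← C_mul, ← C_add, ← hc, C_mul_X_pow_eq_monomial]

theorem ker_polyToAmb {α β : F} (hβ : β ≠ 0) :
    RingHom.ker (polyToAmb F N (lamAdd F α β)) = Ideal.span {(X ^ N - C α) ^ 2} := by
  refine le_antisymm ?_ ?_
  · let G : F[X] := X ^ N - C α
    let B := AdjoinRoot (G ^ 2)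
    let ε : B := AdjoinRoot.mk (G ^ 2) (C β⁻¹ * G)
    have hε : ε * ε = 0 := by
      rw [← map_mul, AdjoinRoot.mk_eq_zero]
      exact ⟨C β⁻¹ * C β⁻¹, by ring⟩
    let i : DualNumber F →ₐ[F] B :=
      DualNumber.lift ⟨(Algebra.ofId F B, ε), hε, fun _ => Commute.all _ _⟩
    have hi_eps : i DualNumber.eps = ε := DualNumber.lift_apply_eps _
    have hroot : eval₂ (i : DualNumber F →+* B) (AdjoinRoot.root (G ^ 2))
        (X ^ N - C (lamAdd F α β)) = 0 := by
      have h : i (lamAdd F α β) = AdjoinRoot.mk (G ^ 2) (C α + G) := by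
        rw [lamAdd, map_add, map_mul, hi_eps, AlgHom.commutes, AlgHom.commutes,
          AdjoinRoot.algebraMap_eq, ← AdjoinRoot.mk_C, ← AdjoinRoot.mk_C, ← map_mul, ← map_add,
          mul_right_comm, ← C_mul, inv_mul_cancel₀ hβ, C_1, one_mul]
      simp only [eval₂_sub, eval₂_X_pow, eval₂_C, RingHom.coe_coe, h]
      rw [← AdjoinRoot.mk_X, ← map_pow, ← map_sub]
      simp [G]
    let ψ : Amb F N (lamAdd F α β) →+* B := AdjoinRoot.lift (i : DualNumber F →+* B) _ hroot
    have hψ : ψ.comp (polyToAmb F N (lamAdd F α β)) = AdjoinRoot.mk (G ^ 2) := by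
      refine Polynomial.ringHom_ext (fun a => ?_) ?_
      · simp only [polyToAmb, RingHom.comp_apply, coe_mapRingHom, map_C, ψ, AdjoinRoot.lift_mk,
          eval₂_C, RingHom.coe_coe, AlgHom.commutes]
        rfl
      · simp only [polyToAmb, RingHom.comp_apply, coe_mapRingHom, map_X, ψ, AdjoinRoot.lift_mk,
          eval₂_X]
        rfl
    intro h hh
    rw [RingHom.mem_ker] at hh
    rw [Ideal.mem_span_singleton, ← AdjoinRoot.mk_eq_zero, ← hψ, RingHom.comp_apply, hh, map_zero]
  · rw [Ideal.span_singleton_le_iff_mem, RingHom.mem_ker, polyToAmb_X_pow_sub_C_sq]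

end Constacyclic

/-- Assume `x^n - α₀` is reducible in `F[x]`, with
`x^n - α₀ = f_1 ⋯ f_r` a product of `r` pairwise distinct monic irreducible polynomials.
Then the number of `(α + uβ)`-constacyclic codes of length `np^s` over `R`, i.e. the number
of ideals of `𝓡 = R[x]/⟨x^{np^s} - (α + uβ)⟩`, is exactly `(2p^s + 1)^r`. -/
theorem stmt_17 (p m n s : ℕ) (hp : p.Prime) (hm : 0 < m) (hn : 0 < n) (hs : 0 < s)
    (hnp : Nat.gcd n p = 1)
    (F : Type) [Field F] [Fintype F] (hF : Fintype.card F = p ^ m)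
    (α β α₀ : F) (hα : α ≠ 0) (hβ : β ≠ 0) (hα₀ : α₀ ^ p ^ s = α)
    (hred : ¬ Irreducible ((X : F[X]) ^ n - C α₀))
    (r : ℕ) (f : Fin r → F[X])
    (hmon : ∀ j, (f j).Monic) (hirr : ∀ j, Irreducible (f j))
    (hdist : ∀ j l, j ≠ l → f j ≠ f l)
    (hfac : ∏ j, f j = (X : F[X]) ^ n - C α₀) :
    Nat.card (Ideal (Amb F (n * p ^ s) (lamAdd F α β))) = (2 * p ^ s + 1) ^ r := by
  have : Fact p.Prime := ⟨hp⟩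
  have : CharP F p := charP_of_card_eq_prime_pow hF
  have hpow : (X : F[X]) ^ (n * p ^ s) - C α = (∏ j, f j) ^ p ^ s := by
    rw [hfac, sub_pow_char_pow, ← C_pow, hα₀, pow_mul]
  have hdist' : Pairwise fun i j => ¬ Associated (f i) (f j) := fun i j hij h =>
    hdist i j hij (eq_of_monic_of_associated (hmon i) (hmon j) h)
  have hker := ker_polyToAmb F (n * p ^ s) (α := α) hβ
  rw [hpow, ← pow_mul, mul_comm (p ^ s) 2, ← Finset.prod_pow] at hker
  simpa using card_ideal_of_ker_eq_span_prod_pow f (fun j => (hirr j).prime) hdist' _ _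
    (polyToAmb_surjective F (n * p ^ s) hβ) hker
end
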